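/- arXiv:2009.04458 — 4 statements merged into one kernel-verified Lean document; each statement's English description precedes it below -/
import Mathlib

section
/- Fix δ₁ > 0 and for every query q let the vector π̃_q(φ, N) be computed by the recursion π₀ = π_q⁰(φ), π_{k+1} = P_q(φ)ᵀ π_k, π̃_q(φ,N) = (α/(1 − (1−α)^{N+1})) Σ_{k=0}^{N} (1−α)^k π_k with N = ⌈(1/α) ln(8r/δ₁)⌉ − 1. Then the value f̃(φ, δ₁) = (1/|Q|) Σ_{q=1}^{|Q|} ‖(A_q π̃_q(φ,N))₊‖₂² satisfies |f̃(φ, δ₁) − f(φ)| ≤ δ₁. -/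
set_option autoImplicit false

open Finset Matrix

/-- Multiplication by the transpose of a row-stochastic matrix does not increase the `ℓ¹` norm. -/
lemma sum_abs_transpose_mulVec_le {n : Type*} [Fintype n] {P : Matrix n n ℝ}
    (hnn : ∀ i j, 0 ≤ P i j) (hrow : ∀ i, ∑ j, P i j = 1) (v : n → ℝ) :
    ∑ j, |(Pᵀ *ᵥ v) j| ≤ ∑ j, |v j| := by
  calc ∑ j, |(Pᵀ *ᵥ v) j| ≤ ∑ j, ∑ i, P i j * |v i| := by
        refine Finset.sum_le_sum fun j _ => ?_
        refine (Finset.abs_sum_le_sum_abs _ _).trans (Finset.sum_le_sum fun i _ => ?_)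
        rw [abs_mul]
        exact (congrArg (· * |v i|) (abs_of_nonneg (hnn i j))).le
    _ = ∑ i, |v i| := by
        rw [Finset.sum_comm]
        refine Finset.sum_congr rfl fun i _ => ?_
        rw [← Finset.sum_mul, hrow, one_mul]

lemma sum_abs_smul {n : Type*} [Fintype n] (c : ℝ) (v : n → ℝ) :
    ∑ j, |(c • v) j| = |c| * ∑ j, |v j| := by
  simp [abs_mul, Finset.mul_sum]

lemma sum_abs_add_le {n : Type*} [Fintype n] (u v : n → ℝ) :
    ∑ j, |(u + v) j| ≤ ∑ j, |u j| + ∑ j, |v j| := by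
  rw [← Finset.sum_add_distrib]
  exact Finset.sum_le_sum fun j _ => abs_add_le _ _

/-- A matrix with entries in `[-1, 1]` maps the `ℓ¹` norm to the sup norm contractively. -/
lemma abs_mulVec_le_sum_abs {m n : Type*} [Fintype n] {A : Matrix m n ℝ} {i : m}
    (hA : ∀ j, |A i j| ≤ 1) (v : n → ℝ) : |(A *ᵥ v) i| ≤ ∑ j, |v j| := by
  refine (Finset.abs_sum_le_sum_abs _ _).trans (Finset.sum_le_sum fun j _ => ?_)
  rw [abs_mul]
  exact mul_le_of_le_one_left (abs_nonneg _) (hA j)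

lemma abs_sq_max_zero_sub_le {x y ε : ℝ} (hx : |x| ≤ 1) (hy : |y| ≤ 1) (h : |x - y| ≤ ε) :
    |max x 0 ^ 2 - max y 0 ^ 2| ≤ 2 * ε := by
  have hx' : max x 0 ≤ 1 := max_le (abs_le.1 hx).2 zero_le_one
  have hy' : max y 0 ≤ 1 := max_le (abs_le.1 hy).2 zero_le_one
  have hx0 : 0 ≤ max x 0 := le_max_right _ _
  have hy0 : 0 ≤ max y 0 := le_max_right _ _
  rw [sq_sub_sq, abs_mul, abs_of_nonneg (add_nonneg hx0 hy0)]
  exact mul_le_mul (by linarith) ((abs_max_sub_max_le_abs x y 0).trans h) (abs_nonneg _)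
    (by norm_num)

/-- The truncation error of the power series: the stationary distribution is a combination of the
normalized partial sum and a remainder of `ℓ¹` norm at most one. -/
lemma exists_pagerank_remainder {n : Type*} [Fintype n] {P : Matrix n n ℝ}
    (hnn : ∀ i j, 0 ≤ P i j) (hrow : ∀ i, ∑ j, P i j = 1) {α : ℝ} {p : n → ℝ} {s : ℕ → n → ℝ}
    (hp : p = α • s 0 + (1 - α) • (Pᵀ *ᵥ p)) (hs : ∀ k, s (k + 1) = Pᵀ *ᵥ s k)
    (hp1 : ∑ j, |p j| ≤ 1) (m : ℕ) :
    ∃ w : n → ℝ, ∑ j, |w j| ≤ 1 ∧ w = α • s m + (1 - α) • (Pᵀ *ᵥ w) ∧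
      p = α • ∑ k ∈ Finset.range m, (1 - α) ^ k • s k + (1 - α) ^ m • w := by
  induction m with
  | zero => exact ⟨p, hp1, hp, by simp⟩
  | succ m ih =>
    obtain ⟨w, hw1, hw, hpw⟩ := ih
    refine ⟨Pᵀ *ᵥ w, (sum_abs_transpose_mulVec_le hnn hrow w).trans hw1, ?_, ?_⟩
    · conv_lhs => rw [hw]
      rw [Matrix.mulVec_add, Matrix.mulVec_smul, Matrix.mulVec_smul, hs]
    · rw [Finset.sum_range_succ]
      conv_lhs => rw [hpw, hw]
      rw [pow_succ]
      module

lemma one_sub_pow_le_of_log_le {α x : ℝ} (hα : α ∈ Set.Ioo (0 : ℝ) 1) (hx : 0 < x) {n : ℕ}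
    (h : 1 / α * Real.log x ≤ n) : (1 - α) ^ n ≤ 1 / x := by
  have h0 : (0 : ℝ) ≤ 1 - α := by linarith [hα.2]
  calc (1 - α) ^ n ≤ Real.exp (-α) ^ n := pow_le_pow_left₀ h0 (Real.one_sub_le_exp_neg α) n
    _ = Real.exp (-(n * α)) := by rw [← Real.exp_nat_mul]; congr 1; ring
    _ ≤ Real.exp (-Real.log x) := by
        refine Real.exp_le_exp.2 (neg_le_neg ?_)
        rw [one_div, inv_mul_eq_div, div_le_iff₀ hα.1] at h
        exact h
    _ = 1 / x := by rw [Real.exp_neg, Real.exp_log hx, one_div]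

/-- Lemma 1 (Bogolubsky et al., NeurIPS 2016): if for every query `q` the stationary
distribution of the supervised PageRank model is approximated by the truncated
power series with `N = ⌈(1/α) ln(8r/δ₁)⌉ − 1` terms, then the resulting approximate
value of the loss function is within `δ₁` of the true loss value. -/
theorem pagerank_loss_value_approximation
    {Qs : Type*} [Fintype Qs] [Nonempty Qs]
    (pq rq : Qs → ℕ)
    -- transition matrices (row-stochastic) and restart distributions
    (Pm : ∀ q : Qs, Matrix (Fin (pq q)) (Fin (pq q)) ℝ)
    (hPnn : ∀ q i j, 0 ≤ Pm q i j) (hProw : ∀ q i, ∑ j, Pm q i j = 1)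
    (π0 : ∀ q : Qs, Fin (pq q) → ℝ)
    (hπ0nn : ∀ q i, 0 ≤ π0 q i) (hπ0sum : ∀ q, ∑ i, π0 q i = 1)
    -- the matrices A_q : each row has one entry 1, one entry −1, zeros elsewhere
    (A : ∀ q : Qs, Matrix (Fin (rq q)) (Fin (pq q)) ℝ)
    (hA : ∀ q i, ∃ j₁ j₂, j₁ ≠ j₂ ∧ A q i j₁ = 1 ∧ A q i j₂ = -1 ∧
      ∀ j, j ≠ j₁ → j ≠ j₂ → A q i j = 0)
    -- damping factor
    (α : ℝ) (hα : α ∈ Set.Ioo (0 : ℝ) 1)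
    -- the stationary distributions
    (π : ∀ q : Qs, Fin (pq q) → ℝ)
    (hπ : ∀ q, π q = α • π0 q + (1 - α) • ((Pm q)ᵀ *ᵥ π q))
    -- r = max_q r_q
    (r : ℕ) (hr : ∀ q, rq q ≤ r) (hr1 : 1 ≤ r)
    -- accuracy and number of terms of the power series
    (δ₁ : ℝ) (hδ₁ : 0 < δ₁)
    (N : ℕ) (hN : N = (⌈(1 / α) * Real.log (8 * r / δ₁)⌉ - 1).toNat)
    -- the power-series approximations (method (17))
    (πs : ∀ q : Qs, ℕ → Fin (pq q) → ℝ)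
    (hπs0 : ∀ q, πs q 0 = π0 q)
    (hπsrec : ∀ q k, πs q (k + 1) = (Pm q)ᵀ *ᵥ πs q k)
    (πt : ∀ q : Qs, Fin (pq q) → ℝ)
    (hπt : ∀ q, πt q
      = (α / (1 - (1 - α) ^ (N + 1))) • ∑ k ∈ Finset.range (N + 1), (1 - α) ^ k • πs q k) :
    |(1 / (Fintype.card Qs : ℝ)) * ∑ q, (∑ i, max (((A q) *ᵥ (πt q)) i) 0 ^ 2)
      - (1 / (Fintype.card Qs : ℝ)) * ∑ q, (∑ i, max (((A q) *ᵥ (π q)) i) 0 ^ 2)| ≤ δ₁ := by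
  obtain ⟨hα0, hα1⟩ := hα
  set t : ℝ := (1 - α) ^ (N + 1) with ht
  have hβ0 : 0 ≤ 1 - α := by linarith
  have ht0 : 0 ≤ t := pow_nonneg hβ0 _
  have ht1 : t < 1 := pow_lt_one₀ hβ0 (by linarith) (Nat.succ_ne_zero N)
  have hr0 : (0 : ℝ) < r := by exact_mod_cast hr1
  have htδ : t ≤ 1 / (8 * r / δ₁) := by
    refine one_sub_pow_le_of_log_le ⟨hα0, hα1⟩ (by positivity) ((Int.le_ceil _).trans ?_)
    have : ⌈(1 / α) * Real.log (8 * r / δ₁)⌉ ≤ ((N + 1 : ℕ) : ℤ) := by omega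
    exact_mod_cast this
  have hrt : r * (4 * t) ≤ δ₁ := by
    rw [one_div_div, le_div_iff₀ (by positivity)] at htδ
    nlinarith [mul_nonneg hr0.le ht0]
  have hA1 : ∀ q i j, |A q i j| ≤ 1 := by
    intro q i j
    obtain ⟨j₁, j₂, -, h1, h2, h3⟩ := hA q i
    by_cases e1 : j = j₁
    · simp [e1, h1]
    by_cases e2 : j = j₂
    · simp [e2, h2]
    simp [h3 j e1 e2]
  have hs1 : ∀ q k, ∑ j, |πs q k j| ≤ 1 := by
    intro q k
    induction k with
    | zero => simp [hπs0, abs_of_nonneg (hπ0nn q _), hπ0sum]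
    | succ k ih =>
      rw [hπsrec]
      exact (sum_abs_transpose_mulVec_le (hPnn q) (hProw q) _).trans ih
  have hπ1 : ∀ q, ∑ j, |π q j| ≤ 1 := by
    intro q
    have h := sum_abs_add_le (α • π0 q) ((1 - α) • ((Pm q)ᵀ *ᵥ π q))
    rw [← hπ q, sum_abs_smul, sum_abs_smul, abs_of_pos hα0, abs_of_nonneg hβ0,
      ← hπs0 q] at h
    have h1 := mul_le_mul_of_nonneg_left (hs1 q 0) hα0.le
    have h2 := mul_le_mul_of_nonneg_left
      (sum_abs_transpose_mulVec_le (hPnn q) (hProw q) (π q)) hβ0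
    nlinarith
  have hc0 : 0 < 1 - t := by linarith
  have hgeom : α * ∑ k ∈ Finset.range (N + 1), (1 - α) ^ k = 1 - t := by
    have := geom_sum_mul (1 - α) (N + 1)
    linarith
  have hπt1 : ∀ q, ∑ j, |πt q j| ≤ 1 := by
    intro q
    rw [hπt, sum_abs_smul, abs_of_nonneg (by positivity), div_mul_eq_mul_div, div_le_one hc0,
      ← hgeom]
    refine mul_le_mul_of_nonneg_left ?_ hα0.le
    calc ∑ j, |(∑ k ∈ Finset.range (N + 1), (1 - α) ^ k • πs q k) j|
        ≤ ∑ j, ∑ k ∈ Finset.range (N + 1), (1 - α) ^ k * |πs q k j| := by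
          refine Finset.sum_le_sum fun j _ => ?_
          rw [Finset.sum_apply]
          refine (Finset.abs_sum_le_sum_abs _ _).trans (Finset.sum_le_sum fun k _ => ?_)
          rw [Pi.smul_apply, smul_eq_mul, abs_mul, abs_of_nonneg (pow_nonneg hβ0 k)]
      _ = ∑ k ∈ Finset.range (N + 1), (1 - α) ^ k * ∑ j, |πs q k j| := by
          rw [Finset.sum_comm]
          simp only [Finset.mul_sum]
      _ ≤ ∑ k ∈ Finset.range (N + 1), (1 - α) ^ k :=
          Finset.sum_le_sum fun k _ => mul_le_of_le_one_right (pow_nonneg hβ0 k) (hs1 q k)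
  have hdiff : ∀ q i, |((A q) *ᵥ (πt q)) i - ((A q) *ᵥ (π q)) i| ≤ 2 * t := by
    intro q i
    obtain ⟨w, hw1, -, hw⟩ := exists_pagerank_remainder (hPnn q) (hProw q)
      (by rw [hπs0]; exact hπ q) (hπsrec q) (hπ1 q) (N + 1)
    have hS : (1 - t) • πt q
        = α • ∑ k ∈ Finset.range (N + 1), (1 - α) ^ k • πs q k := by
      rw [hπt, smul_smul, mul_div_cancel₀ _ hc0.ne']
    rw [← hS, ← ht] at hw
    have e : ((A q) *ᵥ (πt q)) i - ((A q) *ᵥ (π q)) i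
        = t * (((A q) *ᵥ (πt q)) i - ((A q) *ᵥ w) i) := by
      rw [hw, Matrix.mulVec_add, Matrix.mulVec_smul, Matrix.mulVec_smul]
      simp only [Pi.add_apply, Pi.smul_apply, smul_eq_mul]
      ring
    have hb := (abs_sub (((A q) *ᵥ (πt q)) i) (((A q) *ᵥ w) i)).trans
      (add_le_add ((abs_mulVec_le_sum_abs (hA1 q i) _).trans (hπt1 q))
        ((abs_mulVec_le_sum_abs (hA1 q i) _).trans hw1))
    rw [e, abs_mul, abs_of_nonneg ht0]
    nlinarith
  have hq : ∀ q, |(∑ i, max (((A q) *ᵥ (πt q)) i) 0 ^ 2)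
      - ∑ i, max (((A q) *ᵥ (π q)) i) 0 ^ 2| ≤ δ₁ := by
    intro q
    rw [← Finset.sum_sub_distrib]
    calc _ ≤ ∑ i, |max (((A q) *ᵥ (πt q)) i) 0 ^ 2 - max (((A q) *ᵥ (π q)) i) 0 ^ 2| :=
          Finset.abs_sum_le_sum_abs _ _
      _ ≤ ∑ _i : Fin (rq q), 2 * (2 * t) := Finset.sum_le_sum fun i _ =>
          abs_sq_max_zero_sub_le ((abs_mulVec_le_sum_abs (hA1 q i) _).trans (hπt1 q))
            ((abs_mulVec_le_sum_abs (hA1 q i) _).trans (hπ1 q)) (hdiff q i)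
      _ = rq q * (4 * t) := by
          rw [Finset.sum_const, Finset.card_univ, Fintype.card_fin, nsmul_eq_mul]
          ring
      _ ≤ r * (4 * t) := by
          gcongr
          exact hr q
      _ ≤ δ₁ := hrt
  have hcard : (0 : ℝ) < Fintype.card Qs := by exact_mod_cast Fintype.card_pos
  rw [← mul_sub, ← Finset.sum_sub_distrib, abs_mul, abs_of_pos (by positivity), one_div,
    inv_mul_eq_div, div_le_iff₀ hcard]
  calc _ ≤ ∑ q, _ := Finset.abs_sum_le_sum_abs _ _
    _ ≤ ∑ _q : Qs, δ₁ := Finset.sum_le_sum fun q _ => hq q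
    _ = δ₁ * Fintype.card Qs := by
        rw [Finset.sum_const, Finset.card_univ, nsmul_eq_mul, mul_comm]
end

section
/- Let β₁ satisfy α‖dπ_q⁰(φ)/dφᵀ‖₁ + (1−α) Σ_{i=1}^{p_q} ‖dp_i(φ)/dφᵀ‖₁ ≤ β₁ for all φ ∈ Φ and all q, where ‖A‖₁ = max_j Σ_i |a_{ij}| and p_i(φ) is the i-th column of P_qᵀ(φ). For each q, let π̃_q(φ, N₁) be computed by the power-series recursion with N₁ = ⌈(1/α) ln(24 β₁ r/(α δ₂))⌉ − 1, and let Π̃_q(φ, N₂) = (1/(1 − (1−α)^{N₂+1})) Σ_{k=0}^{N₂} (1−α)^k Π_k, where Π₀ = α dπ_q⁰(φ)/dφᵀ + (1−α) Σ_{i=1}^{p_q} (dp_i(φ)/dφᵀ)[π̃_q(φ,N₁)]_i, Π_{k+1} = P_qᵀ(φ) Π_k, and N₂ = ⌈(1/α) ln(8 β₁ r/(α δ₂))⌉ − 1. Then the vector g̃(φ, δ₂) = (2/|Q|) Σ_{q=1}^{|Q|} Π̃_q(φ, N₂)ᵀ A_qᵀ (A_q π̃_q(φ, N₁))₊ satisfies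 ‖g̃(φ, δ₂) − ∇f(φ)‖_∞ ≤ δ₂. -/
set_option autoImplicit false

open Finset Matrix

/-- The `ℓ¹`-norm of a vector. -/
def l1Norm {ι : Type*} [Fintype ι] (x : ι → ℝ) : ℝ := ∑ i, |x i|

section L1Norm

variable {ι : Type*} [Fintype ι]

theorem l1Norm_nonneg (x : ι → ℝ) : 0 ≤ l1Norm x :=
  sum_nonneg fun _ _ => abs_nonneg _

theorem abs_apply_le_l1Norm (x : ι → ℝ) (i : ι) : |x i| ≤ l1Norm x :=
  single_le_sum (f := fun i => |x i|) (fun _ _ => abs_nonneg _) (mem_univ i)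

theorem l1Norm_add_le (x y : ι → ℝ) : l1Norm (x + y) ≤ l1Norm x + l1Norm y := by
  unfold l1Norm
  rw [← sum_add_distrib]
  exact sum_le_sum fun i _ => abs_add_le _ _

theorem l1Norm_smul (c : ℝ) (x : ι → ℝ) : l1Norm (c • x) = |c| * l1Norm x := by
  simp [l1Norm, abs_mul, mul_sum]

theorem l1Norm_sub_le (x y : ι → ℝ) : l1Norm (x - y) ≤ l1Norm x + l1Norm y := by
  unfold l1Norm
  rw [← sum_add_distrib]
  exact sum_le_sum fun i _ => abs_sub _ _

theorem l1Norm_sum_le {κ : Type*} (s : Finset κ) (f : κ → ι → ℝ) :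
    l1Norm (∑ k ∈ s, f k) ≤ ∑ k ∈ s, l1Norm (f k) := by
  unfold l1Norm
  rw [sum_comm]
  refine sum_le_sum fun i _ => ?_
  rw [Finset.sum_apply]
  exact abs_sum_le_sum_abs _ _

theorem abs_dotProduct_le (x y : ι → ℝ) (c : ℝ) (hy : ∀ i, |y i| ≤ c) :
    |x ⬝ᵥ y| ≤ l1Norm x * c := by
  unfold l1Norm dotProduct
  rw [sum_mul]
  refine (abs_sum_le_sum_abs _ _).trans (sum_le_sum fun i _ => ?_)
  rw [abs_mul]
  exact mul_le_mul_of_nonneg_left (hy i) (abs_nonneg _)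

end L1Norm

section DampedSeries

variable {ι : Type*} [Fintype ι]

theorem l1Norm_transpose_mulVec_le {P : Matrix ι ι ℝ}
    (hP : ∀ i j, 0 ≤ P i j) (hrow : ∀ i, ∑ j, P i j = 1) (x : ι → ℝ) :
    l1Norm (Pᵀ *ᵥ x) ≤ l1Norm x := by
  calc l1Norm (Pᵀ *ᵥ x) ≤ ∑ i, ∑ j, P j i * |x j| := by
        refine sum_le_sum fun i _ => (abs_sum_le_sum_abs _ _).trans
          (sum_le_sum fun j _ => ?_)
        change |P j i * x j| ≤ _
        rw [abs_mul, abs_of_nonneg (hP j i)]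
    _ = l1Norm x := by
        rw [sum_comm]
        exact sum_congr rfl fun j _ => by rw [← sum_mul, hrow, one_mul]

variable {P : Matrix ι ι ℝ} {α : ℝ} {b y : ι → ℝ} {s : ℕ → ι → ℝ}

theorem l1Norm_recursion_le (hP : ∀ i j, 0 ≤ P i j) (hrow : ∀ i, ∑ j, P i j = 1)
    (hs : ∀ k, s (k + 1) = Pᵀ *ᵥ s k) (k : ℕ) : l1Norm (s k) ≤ l1Norm (s 0) := by
  induction k with
  | zero => exact le_rfl
  | succ k ih => rw [hs]; exact (l1Norm_transpose_mulVec_le hP hrow _).trans ih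

theorem l1Norm_le_of_damped_fixedPoint (hP : ∀ i j, 0 ≤ P i j) (hrow : ∀ i, ∑ j, P i j = 1)
    (hα : α ∈ Set.Ioo (0 : ℝ) 1) (hy : y = b + (1 - α) • (Pᵀ *ᵥ y)) :
    l1Norm y ≤ l1Norm b / α := by
  have h1 : l1Norm y ≤ l1Norm b + (1 - α) * l1Norm y := by
    have h := l1Norm_add_le b ((1 - α) • (Pᵀ *ᵥ y))
    rw [← hy, l1Norm_smul, abs_of_pos (sub_pos.2 hα.2)] at h
    exact h.trans (by
      gcongr
      · exact (sub_pos.2 hα.2).le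
      · exact l1Norm_transpose_mulVec_le hP hrow _)
  rw [le_div_iff₀ hα.1]
  linarith

theorem one_sub_one_sub_pow_pos (hα : α ∈ Set.Ioo (0 : ℝ) 1) (n : ℕ) :
    0 < 1 - (1 - α) ^ (n + 1) :=
  sub_pos.2 (pow_lt_one₀ (sub_pos.2 hα.2).le (by linarith [hα.1]) n.succ_ne_zero)

/-- The normalized truncated power series obeys the same `ℓ¹`-bound as the full series. -/
theorem l1Norm_normalized_series_le (hP : ∀ i j, 0 ≤ P i j) (hrow : ∀ i, ∑ j, P i j = 1)
    (hα : α ∈ Set.Ioo (0 : ℝ) 1) (hs : ∀ k, s (k + 1) = Pᵀ *ᵥ s k) (n : ℕ) :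
    l1Norm ((1 / (1 - (1 - α) ^ (n + 1))) • ∑ k ∈ range (n + 1), (1 - α) ^ k • s k)
      ≤ l1Norm (s 0) / α := by
  have hpos := one_sub_one_sub_pow_pos hα n
  have h1α : 0 ≤ 1 - α := (sub_pos.2 hα.2).le
  have hgeom : (∑ k ∈ range (n + 1), (1 - α) ^ k) * α = 1 - (1 - α) ^ (n + 1) := by
    have := geom_sum_mul_neg (1 - α) (n + 1)
    rwa [sub_sub_cancel] at this
  have hsum : l1Norm (∑ k ∈ range (n + 1), (1 - α) ^ k • s k)
      ≤ (∑ k ∈ range (n + 1), (1 - α) ^ k) * l1Norm (s 0) := by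
    rw [sum_mul]
    refine (l1Norm_sum_le _ _).trans (sum_le_sum fun k _ => ?_)
    rw [l1Norm_smul, abs_of_nonneg (pow_nonneg h1α k)]
    exact mul_le_mul_of_nonneg_left (l1Norm_recursion_le hP hrow hs k) (pow_nonneg h1α k)
  rw [l1Norm_smul, abs_of_pos (one_div_pos.2 hpos), le_div_iff₀ hα.1, one_div, mul_assoc,
    inv_mul_le_iff₀ hpos, ← hgeom]
  nlinarith [mul_le_mul_of_nonneg_right hsum hα.1.le]

theorem damped_fixedPoint_eq_series_add
    (hy : y = s 0 + (1 - α) • (Pᵀ *ᵥ y)) (hs : ∀ k, s (k + 1) = Pᵀ *ᵥ s k) {t : ℕ → ι → ℝ}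
    (ht0 : t 0 = y) (ht : ∀ k, t (k + 1) = Pᵀ *ᵥ t k) (n : ℕ) :
    y = ∑ k ∈ range n, (1 - α) ^ k • s k + (1 - α) ^ n • t n := by
  have key : ∀ k, t k = s k + (1 - α) • t (k + 1) := by
    intro k
    induction k with
    | zero => rw [ht, ht0]; exact hy
    | succ k ih =>
      rw [ht (k + 1), ht k, hs k, ← mulVec_smul, ← mulVec_add]
      congr 1
      rw [← ht k]
      exact ih
  induction n with
  | zero => simp [ht0]
  | succ n ih =>
    rw [sum_range_succ, add_assoc, pow_succ, mul_smul, ← smul_add, ← key]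
    exact ih

/-- The error of the normalized truncated power series with a perturbed right-hand side. -/
theorem l1Norm_normalized_series_sub_le (hP : ∀ i j, 0 ≤ P i j) (hrow : ∀ i, ∑ j, P i j = 1)
    (hα : α ∈ Set.Ioo (0 : ℝ) 1) (hy : y = b + (1 - α) • (Pᵀ *ᵥ y))
    (hs : ∀ k, s (k + 1) = Pᵀ *ᵥ s k) (n : ℕ) :
    l1Norm ((1 / (1 - (1 - α) ^ (n + 1))) • (∑ k ∈ range (n + 1), (1 - α) ^ k • s k) - y)
      ≤ (l1Norm (s 0 - b) + 2 * (1 - α) ^ (n + 1) * l1Norm b) / α := by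
  set u : ℕ → ι → ℝ := fun k => (fun x => Pᵀ *ᵥ x)^[k] b with hu_def
  set t : ℕ → ι → ℝ := fun k => (fun x => Pᵀ *ᵥ x)^[k] y with ht_def
  have hu : ∀ k, u (k + 1) = Pᵀ *ᵥ u k := fun k => Function.iterate_succ_apply' _ _ _
  have ht : ∀ k, t (k + 1) = Pᵀ *ᵥ t k := fun k => Function.iterate_succ_apply' _ _ _
  have hd : ∀ k, (s - u) (k + 1) = Pᵀ *ᵥ (s - u) k := fun k => by
    simp only [Pi.sub_apply, hs, hu, mulVec_sub]
  have hpos := one_sub_one_sub_pow_pos hα n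
  have hε : 0 ≤ (1 - α) ^ (n + 1) := pow_nonneg (sub_pos.2 hα.2).le _
  have hser := damped_fixedPoint_eq_series_add (s := u) (t := t) hy hu rfl ht (n + 1)
  set ε := (1 - α) ^ (n + 1) with hε_def
  set Y := (1 / (1 - ε)) • ∑ k ∈ range (n + 1), (1 - α) ^ k • u k with hY
  have hY' : (1 - ε) • Y = y - ε • t (n + 1) := by
    rw [hY, smul_smul, mul_one_div_cancel hpos.ne', one_smul]
    exact eq_sub_of_add_eq hser.symm
  have hdecomp : (1 / (1 - ε)) • (∑ k ∈ range (n + 1), (1 - α) ^ k • s k) - y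
      = (1 / (1 - ε)) • (∑ k ∈ range (n + 1), (1 - α) ^ k • (s - u) k)
        + ε • (Y - t (n + 1)) := by
    have h1 : ε • (Y - t (n + 1)) = Y - y := by
      have : y = (1 - ε) • Y + ε • t (n + 1) := by rw [hY']; abel
      rw [this]
      module
    rw [h1, hY]
    simp only [Pi.sub_apply, smul_sub, sum_sub_distrib]
    abel
  rw [hdecomp]
  have e1 := l1Norm_normalized_series_le hP hrow hα hd n
  have e2 := l1Norm_normalized_series_le hP hrow hα hu n
  have e3 := (l1Norm_recursion_le hP hrow ht (n + 1)).trans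
    (l1Norm_le_of_damped_fixedPoint hP hrow hα hy)
  have e4 := (l1Norm_sub_le Y (t (n + 1))).trans (add_le_add e2 e3)
  refine (l1Norm_add_le _ _).trans ?_
  rw [l1Norm_smul ε, abs_of_nonneg hε, add_div]
  refine add_le_add e1 ((mul_le_mul_of_nonneg_left e4 hε).trans (le_of_eq ?_))
  simp only [hu_def, Function.iterate_zero, id]
  ring

end DampedSeries

/-- The prescribed number of terms makes the tail weight of the power series small. -/
theorem one_sub_pow_le_inv_of_ceil_log {α X : ℝ} (hα : α ∈ Set.Ioo (0 : ℝ) 1) (hX : 0 < X)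
    {N : ℕ} (hN : N = (⌈(1 / α) * Real.log X⌉ - 1).toNat) : (1 - α) ^ (N + 1) ≤ X⁻¹ := by
  have h1 : (1 / α) * Real.log X ≤ (N : ℝ) + 1 := by
    refine (Int.le_ceil _).trans ?_
    have : ⌈(1 / α) * Real.log X⌉ ≤ (N : ℤ) + 1 := by omega
    exact_mod_cast this
  have h2 : Real.log X ≤ α * ((N : ℝ) + 1) := by
    rw [one_div, inv_mul_le_iff₀ hα.1] at h1
    exact h1
  calc (1 - α) ^ (N + 1) ≤ Real.exp (-α) ^ (N + 1) :=
        pow_le_pow_left₀ (sub_pos.2 hα.2).le (Real.one_sub_le_exp_neg α) _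
    _ = Real.exp (-(α * ((N : ℝ) + 1))) := by
        rw [← Real.exp_nat_mul]; push_cast; ring_nf
    _ ≤ Real.exp (-Real.log X) := Real.exp_le_exp.2 (neg_le_neg h2)
    _ = X⁻¹ := by rw [Real.exp_neg, Real.exp_log hX]

section Comparison

variable {κ ι : Type*} {A : Matrix κ ι ℝ}

/-- Each row of the matrix has one entry `1`, one entry `-1`, and zeros elsewhere. -/
def IsComparisonMatrix (A : Matrix κ ι ℝ) : Prop :=
  ∀ i, ∃ j₁ j₂, j₁ ≠ j₂ ∧ A i j₁ = 1 ∧ A i j₂ = -1 ∧ ∀ j, j ≠ j₁ → j ≠ j₂ → A i j = 0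

theorem IsComparisonMatrix.abs_le_one (hA : IsComparisonMatrix A) (i : κ) (j : ι) :
    |A i j| ≤ 1 := by
  obtain ⟨j₁, j₂, -, h1, h2, h0⟩ := hA i
  by_cases e1 : j = j₁
  · simp [e1, h1]
  by_cases e2 : j = j₂
  · simp [e2, h2]
  simp [h0 j e1 e2]

theorem IsComparisonMatrix.abs_transpose_mulVec_le [Fintype κ] (hA : IsComparisonMatrix A)
    {v : κ → ℝ} {c : ℝ} (hv : ∀ i, |v i| ≤ c) (j : ι) : |(Aᵀ *ᵥ v) j| ≤ Fintype.card κ * c := by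
  refine (abs_sum_le_sum_abs _ _).trans ?_
  calc ∑ i, |Aᵀ j i * v i| ≤ ∑ _i : κ, c := sum_le_sum fun i _ => by
        rw [abs_mul]
        exact (mul_le_of_le_one_left (abs_nonneg _) (hA.abs_le_one i j)).trans (hv i)
    _ = Fintype.card κ * c := by simp

variable [Fintype ι]

theorem IsComparisonMatrix.abs_mulVec_le (hA : IsComparisonMatrix A) (x : ι → ℝ) (i : κ) :
    |(A *ᵥ x) i| ≤ l1Norm x := by
  refine (abs_sum_le_sum_abs _ _).trans (sum_le_sum fun j _ => ?_)
  rw [abs_mul]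
  exact mul_le_of_le_one_left (abs_nonneg _) (hA.abs_le_one i j)

/-- Perturbation bound for the pairing of a Jacobian column with the gradient of the
squared positive part of `A *ᵥ x`. -/
theorem IsComparisonMatrix.abs_dotProduct_sub_le [Fintype κ] (hA : IsComparisonMatrix A)
    {u w x y : ι → ℝ} (hx : l1Norm x ≤ 1) :
    |u ⬝ᵥ (Aᵀ *ᵥ fun i => max ((A *ᵥ x) i) 0) - w ⬝ᵥ (Aᵀ *ᵥ fun i => max ((A *ᵥ y) i) 0)|
      ≤ Fintype.card κ * (l1Norm (u - w) + l1Norm w * l1Norm (x - y)) := by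
  set v : κ → ℝ := fun i => max ((A *ᵥ x) i) 0
  set v' : κ → ℝ := fun i => max ((A *ᵥ y) i) 0
  have hv : ∀ i, |v i| ≤ 1 := fun i => by
    have h := (hA.abs_mulVec_le x i).trans hx
    rw [abs_of_nonneg (le_max_right _ _)]
    exact max_le ((le_abs_self _).trans h) zero_le_one
  have hvv' : ∀ i, |(v - v') i| ≤ l1Norm (x - y) := fun i => by
    have h := hA.abs_mulVec_le (x - y) i
    rw [mulVec_sub] at h
    exact (abs_max_sub_max_le_abs _ _ _).trans h
  have hsplit : u ⬝ᵥ (Aᵀ *ᵥ v) - w ⬝ᵥ (Aᵀ *ᵥ v')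
      = (u - w) ⬝ᵥ (Aᵀ *ᵥ v) + w ⬝ᵥ (Aᵀ *ᵥ (v - v')) := by
    rw [mulVec_sub, dotProduct_sub, sub_dotProduct]
    ring
  rw [hsplit]
  have e1 := abs_dotProduct_le (u - w) _ _ (hA.abs_transpose_mulVec_le hv)
  have e2 := abs_dotProduct_le w _ _ (hA.abs_transpose_mulVec_le hvv')
  refine (abs_add_le _ _).trans ((add_le_add e1 e2).trans (le_of_eq ?_))
  ring

end Comparison

theorem l1Norm_sum_smul_le {ι : Type*} [Fintype ι] (x : ι → ℝ) (D : ι → ι → ℝ) :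
    l1Norm (∑ i, x i • D i) ≤ l1Norm x * ∑ i, l1Norm (D i) := by
  rw [mul_sum]
  refine (l1Norm_sum_le _ _).trans (sum_le_sum fun i _ => ?_)
  rw [l1Norm_smul]
  exact mul_le_mul_of_nonneg_right (abs_apply_le_l1Norm x i) (l1Norm_nonneg _)

/-- The error of the approximate Jacobian column, given an approximation `x'` of the
fixed point `x` on which the right-hand side depends. -/
theorem l1Norm_jacobian_column_sub_le {ι : Type*} [Fintype ι] {P : Matrix ι ι ℝ} {α β ε : ℝ}
    (hP : ∀ i j, 0 ≤ P i j) (hrow : ∀ i, ∑ j, P i j = 1) (hα : α ∈ Set.Ioo (0 : ℝ) 1)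
    {c x x' y : ι → ℝ} {D : ι → ι → ℝ} {s : ℕ → ι → ℝ}
    (hβ : α * l1Norm c + (1 - α) * ∑ i, l1Norm (D i) ≤ β)
    (hx : l1Norm x ≤ 1) (hxx' : l1Norm (x' - x) ≤ ε)
    (hy : y = α • c + (1 - α) • (∑ i, x i • D i) + (1 - α) • (Pᵀ *ᵥ y))
    (hs0 : s 0 = α • c + (1 - α) • (∑ i, x' i • D i)) (hs : ∀ k, s (k + 1) = Pᵀ *ᵥ s k)
    (n : ℕ) :
    l1Norm y ≤ β / α ∧
    l1Norm ((1 / (1 - (1 - α) ^ (n + 1))) • (∑ k ∈ range (n + 1), (1 - α) ^ k • s k) - y)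
      ≤ (ε * β + 2 * (1 - α) ^ (n + 1) * β) / α := by
  have h1α : 0 < 1 - α := sub_pos.2 hα.2
  have hε0 : 0 ≤ (1 - α) ^ (n + 1) := pow_nonneg h1α.le _
  have hD : 0 ≤ ∑ i, l1Norm (D i) := sum_nonneg fun i _ => l1Norm_nonneg _
  have hb : l1Norm (α • c + (1 - α) • (∑ i, x i • D i)) ≤ β := by
    refine (l1Norm_add_le _ _).trans (le_trans ?_ hβ)
    rw [l1Norm_smul, l1Norm_smul, abs_of_pos hα.1, abs_of_pos h1α]
    gcongr
    exact (l1Norm_sum_smul_le x D).trans (mul_le_of_le_one_left hD hx)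
  have hd : l1Norm (s 0 - (α • c + (1 - α) • (∑ i, x i • D i))) ≤ ε * β := by
    have : s 0 - (α • c + (1 - α) • (∑ i, x i • D i))
        = (1 - α) • ∑ i, (x' - x) i • D i := by
      rw [hs0]
      simp only [Pi.sub_apply, sub_smul, sum_sub_distrib, smul_sub]
      abel
    rw [this, l1Norm_smul, abs_of_pos h1α]
    have hDβ : (1 - α) * ∑ i, l1Norm (D i) ≤ β := by
      have := mul_nonneg hα.1.le (l1Norm_nonneg c)
      linarith
    calc (1 - α) * l1Norm (∑ i, (x' - x) i • D i)
        ≤ (1 - α) * (l1Norm (x' - x) * ∑ i, l1Norm (D i)) := by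
          gcongr
          exact l1Norm_sum_smul_le _ _
      _ = l1Norm (x' - x) * ((1 - α) * ∑ i, l1Norm (D i)) := by ring
      _ ≤ ε * β := mul_le_mul hxx' hDβ (mul_nonneg h1α.le hD)
          ((l1Norm_nonneg _).trans hxx')
  constructor
  · exact (l1Norm_le_of_damped_fixedPoint hP hrow hα hy).trans
      (div_le_div_of_nonneg_right hb hα.1.le)
  · refine (l1Norm_normalized_series_sub_le hP hrow hα hy hs n).trans
      (div_le_div_of_nonneg_right (add_le_add hd ?_) hα.1.le)
    gcongr

/-- Lemma 2 (Bogolubsky et al., NeurIPS 2016): if for every query `q` the stationary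
distribution is approximated by the truncated power series with `N₁` terms and its
Jacobian (with respect to the parameter vector) by the truncated power series with `N₂`
terms, then the resulting approximation of the gradient of the loss function is within
`δ₂` of the true gradient in the `ℓ∞`-norm. -/
theorem pagerank_loss_gradient_approximation
    {Qs : Type*} [Fintype Qs] [Nonempty Qs] (mdim : ℕ)
    (pq rq : Qs → ℕ)
    -- transition matrices (row-stochastic) and restart distributions at the given φ
    (Pm : ∀ q : Qs, Matrix (Fin (pq q)) (Fin (pq q)) ℝ)
    (hPnn : ∀ q i j, 0 ≤ Pm q i j) (hProw : ∀ q i, ∑ j, Pm q i j = 1)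
    (π0 : ∀ q : Qs, Fin (pq q) → ℝ)
    (hπ0nn : ∀ q i, 0 ≤ π0 q i) (hπ0sum : ∀ q, ∑ i, π0 q i = 1)
    -- the matrices A_q : each row has one entry 1, one entry −1, zeros elsewhere
    (A : ∀ q : Qs, Matrix (Fin (rq q)) (Fin (pq q)) ℝ)
    (hA : ∀ q i, ∃ j₁ j₂, j₁ ≠ j₂ ∧ A q i j₁ = 1 ∧ A q i j₂ = -1 ∧
      ∀ j, j ≠ j₁ → j ≠ j₂ → A q i j = 0)
    -- damping factor
    (α : ℝ) (hα : α ∈ Set.Ioo (0 : ℝ) 1)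
    -- the stationary distributions
    (π : ∀ q : Qs, Fin (pq q) → ℝ)
    (hπ : ∀ q, π q = α • π0 q + (1 - α) • ((Pm q)ᵀ *ᵥ π q))
    -- derivatives of the restart distributions and of the columns of P_qᵀ at the given φ
    (Dπ0 : ∀ q : Qs, Matrix (Fin (pq q)) (Fin mdim) ℝ)
    (Dp : ∀ q : Qs, Fin (pq q) → Matrix (Fin (pq q)) (Fin mdim) ℝ)
    -- the Jacobian of the stationary distribution, which satisfies the fixed-point equation
    (Dπ : ∀ q : Qs, Matrix (Fin (pq q)) (Fin mdim) ℝ)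
    (hDπ : ∀ q, Dπ q = α • Dπ0 q + (1 - α) • (∑ i, (π q i) • Dp q i)
      + (1 - α) • ((Pm q)ᵀ * Dπ q))
    -- the constant β₁ bounding α‖dπ⁰/dφᵀ‖₁ + (1−α)Σᵢ‖dpᵢ/dφᵀ‖₁ (‖·‖₁ = max column sum)
    (β₁ : ℝ) (hβ₁pos : 0 < β₁)
    (hβ₁ : ∀ q : Qs, ∀ j : Fin mdim,
      α * (∑ i', |Dπ0 q i' j|) + (1 - α) * ∑ i, (∑ i', |Dp q i i' j|) ≤ β₁)
    -- r = max_q r_q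
    (r : ℕ) (hr : ∀ q, rq q ≤ r) (hr1 : 1 ≤ r)
    -- accuracy and numbers of terms of the power series
    (δ₂ : ℝ) (hδ₂ : 0 < δ₂)
    (N₁ N₂ : ℕ)
    (hN₁ : N₁ = (⌈(1 / α) * Real.log (24 * β₁ * r / (α * δ₂))⌉ - 1).toNat)
    (hN₂ : N₂ = (⌈(1 / α) * Real.log (8 * β₁ * r / (α * δ₂))⌉ - 1).toNat)
    -- the power-series approximations of the stationary distributions
    (πs : ∀ q : Qs, ℕ → Fin (pq q) → ℝ)
    (hπs0 : ∀ q, πs q 0 = π0 q)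
    (hπsrec : ∀ q k, πs q (k + 1) = (Pm q)ᵀ *ᵥ πs q k)
    (πt : ∀ q : Qs, Fin (pq q) → ℝ)
    (hπt : ∀ q, πt q
      = (α / (1 - (1 - α) ^ (N₁ + 1))) • ∑ k ∈ Finset.range (N₁ + 1), (1 - α) ^ k • πs q k)
    -- the power-series approximations of the Jacobians
    (Pis : ∀ q : Qs, ℕ → Matrix (Fin (pq q)) (Fin mdim) ℝ)
    (hPis0 : ∀ q, Pis q 0 = α • Dπ0 q + (1 - α) • (∑ i, (πt q i) • Dp q i))
    (hPisrec : ∀ q k, Pis q (k + 1) = (Pm q)ᵀ * Pis q k)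
    (Pit : ∀ q : Qs, Matrix (Fin (pq q)) (Fin mdim) ℝ)
    (hPit : ∀ q, Pit q
      = (1 / (1 - (1 - α) ^ (N₂ + 1))) • ∑ k ∈ Finset.range (N₂ + 1), (1 - α) ^ k • Pis q k) :
    ∀ j : Fin mdim,
      |(2 / (Fintype.card Qs : ℝ))
          * (∑ q, ((Pit q)ᵀ *ᵥ ((A q)ᵀ *ᵥ (fun i => max (((A q) *ᵥ (πt q)) i) 0))) j)
        - (2 / (Fintype.card Qs : ℝ))
          * (∑ q, ((Dπ q)ᵀ *ᵥ ((A q)ᵀ *ᵥ (fun i => max (((A q) *ᵥ (π q)) i) 0))) j)| ≤ δ₂ := by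
  intro j
  have hα0 := hα.1
  have hr0 : (0 : ℝ) < r := by exact_mod_cast hr1
  have hε₁ := one_sub_pow_le_inv_of_ceil_log hα (by positivity) hN₁
  have hε₂ := one_sub_pow_le_inv_of_ceil_log hα (by positivity) hN₂
  have hε₁0 : 0 ≤ (1 - α) ^ (N₁ + 1) := pow_nonneg (sub_pos.2 hα.2).le _
  set ε₁ := (1 - α) ^ (N₁ + 1) with hε₁_def
  set ε₂ := (1 - α) ^ (N₂ + 1) with hε₂_def
  rw [inv_div, le_div_iff₀ (by positivity)] at hε₁ hε₂
  have hquery : ∀ q,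
      |((Pit q)ᵀ *ᵥ ((A q)ᵀ *ᵥ (fun i => max (((A q) *ᵥ (πt q)) i) 0))) j
        - ((Dπ q)ᵀ *ᵥ ((A q)ᵀ *ᵥ (fun i => max (((A q) *ᵥ (π q)) i) 0))) j| ≤ δ₂ / 2 := by
    intro q
    have hc : l1Norm (α • π0 q) = α := by
      rw [l1Norm_smul, abs_of_pos hα0, l1Norm, sum_congr rfl fun i _ =>
        abs_of_nonneg (hπ0nn q i), hπ0sum, mul_one]
    obtain ⟨σ, hσ⟩ : ∃ σ : ℕ → Fin (pq q) → ℝ, ∀ k, σ k = α • πs q k := ⟨_, fun _ => rfl⟩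
    have hs : ∀ k, σ (k + 1) = (Pm q)ᵀ *ᵥ σ k := fun k => by
      rw [hσ, hσ, hπsrec, mulVec_smul]
    have hs0 : σ 0 = α • π0 q := by rw [hσ, hπs0]
    have hπt' : πt q = (1 / (1 - (1 - α) ^ (N₁ + 1)))
        • ∑ k ∈ Finset.range (N₁ + 1), (1 - α) ^ k • σ k := by
      rw [hπt, div_eq_mul_one_div, mul_comm, mul_smul, smul_sum]
      simp only [smul_comm α, hσ, ← hε₁_def]
    have hπ1 : l1Norm (π q) ≤ 1 := by
      have h := l1Norm_le_of_damped_fixedPoint (hPnn q) (hProw q) hα (hπ q)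
      rwa [hc, div_self hα0.ne'] at h
    have hπt1 : l1Norm (πt q) ≤ 1 := by
      have h := l1Norm_normalized_series_le (hPnn q) (hProw q) hα hs N₁
      rwa [← hπt', hs0, hc, div_self hα0.ne'] at h
    have hππt : l1Norm (πt q - π q) ≤ 2 * ε₁ := by
      have h := l1Norm_normalized_series_sub_le (hPnn q) (hProw q) hα (hπ q) hs N₁
      rw [← hπt', hs0, hc, sub_self, add_div, mul_div_cancel_right₀ _ hα0.ne'] at h
      simpa [l1Norm] using h
    obtain ⟨hy, hJ⟩ := l1Norm_jacobian_column_sub_le (hPnn q) (hProw q) hα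
      (c := fun i => Dπ0 q i j) (D := fun i i' => Dp q i i' j) (y := fun i => Dπ q i j)
      (s := fun k i => Pis q k i j) (hβ₁ q j) hπ1 hππt
      (by
        ext i
        have h := congrFun (congrFun (hDπ q) i) j
        simpa [Matrix.sum_apply, Finset.sum_apply, mulVec, dotProduct, Matrix.mul_apply] using h)
      (by
        ext i
        have h := congrFun (congrFun (hPis0 q) i) j
        simpa [Matrix.sum_apply, Finset.sum_apply] using h)
      (by
        intro k
        ext i
        rw [hPisrec]
        rfl) N₂
    have hcol : (1 / (1 - (1 - α) ^ (N₂ + 1)))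
        • (∑ k ∈ Finset.range (N₂ + 1), (1 - α) ^ k • fun i => Pis q k i j)
        = fun i => Pit q i j := by
      ext i
      rw [hPit]
      simp [Matrix.sum_apply, Finset.sum_apply, ← hε₂_def]
    rw [hcol] at hJ
    have hbound := IsComparisonMatrix.abs_dotProduct_sub_le (hA q)
      (u := fun i => Pit q i j) (w := fun i => Dπ q i j) (y := π q) hπt1
    rw [Fintype.card_fin] at hbound
    have hrq : (rq q : ℝ) ≤ r := by exact_mod_cast hr q
    refine hbound.trans ?_
    calc (rq q : ℝ) * (l1Norm ((fun i => Pit q i j) - fun i => Dπ q i j)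
          + l1Norm (fun i => Dπ q i j) * l1Norm (πt q - π q))
        ≤ r * ((2 * ε₁ * β₁ + 2 * ε₂ * β₁) / α + β₁ / α * (2 * ε₁)) :=
          mul_le_mul hrq (add_le_add hJ (mul_le_mul hy hππt (l1Norm_nonneg _) (by positivity)))
            (add_nonneg (l1Norm_nonneg _) (mul_nonneg (l1Norm_nonneg _) (l1Norm_nonneg _)))
            hr0.le
      _ = (4 * (ε₁ * (β₁ * r)) + 2 * (ε₂ * (β₁ * r))) / α := by ring
      _ ≤ δ₂ / 2 := by
          rw [div_le_iff₀ hα0]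
          have := mul_pos hα0 hδ₂
          linarith
  have hcard : (0 : ℝ) < Fintype.card Qs := by exact_mod_cast Fintype.card_pos
  rw [← mul_sub, ← sum_sub_distrib, abs_mul, abs_of_pos (by positivity)]
  calc _ ≤ 2 / (Fintype.card Qs : ℝ) * ∑ _q : Qs, δ₂ / 2 := by
        gcongr
        exact (abs_sum_le_sum_abs _ _).trans (sum_le_sum fun q _ => hquery q)
    _ = δ₂ := by
        rw [sum_const, card_univ, nsmul_eq_mul]
        field_simp
end

section
/- Let the sets P ⊆ ℝ^p and Q ⊆ ℝ^q be convex, closed and bounded, F(u,·) be concave and upper semi-continuous in v and F(·,v) be convex and lower semi-continuous in u, Φ(x,y) be continuous, convex in x and concave in y. Then the constrained infinite-dimensional saddle-point problem min_{u∈𝒰, x∈X} max_{v∈𝒱, y∈Y} { F(u,v) + Φ(x,y) : x = x̃₀ + 𝓑u, y = ỹ₀ + 𝓒v } is equivalent to the finite-dimensional conjugate problem min_λ max_μ { min_{u∈𝒰} max_{v∈𝒱} [F(u,v) − ⟨μ, 𝓑u⟩ + ⟨λ, 𝓒v⟩] + min_{x∈X} max_{y∈Y} [Φ(x,y) + ⟨μ,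 x⟩ − ⟨λ, y⟩] − ⟨μ, x̃₀⟩ + ⟨λ, ỹ₀⟩ }, where λ ∈ ℝ^m, μ ∈ ℝ^n. -/
set_option autoImplicit false

open MeasureTheory RealInnerProductSpace

section ConvexHilbert

open Filter Topology

variable {H E : Type*} [NormedAddCommGroup H] [InnerProductSpace ℝ H] [CompleteSpace H]
  [NormedAddCommGroup E] [InnerProductSpace ℝ E]

/-- A nonempty closed convex subset of a Hilbert space has an element of least norm. -/
lemma exists_forall_norm_le_of_isClosed_convex {S : Set H} (hne : S.Nonempty)
    (hcl : IsClosed S) (hconv : Convex ℝ S) : ∃ x ∈ S, ∀ w ∈ S, ‖x‖ ≤ ‖w‖ := by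
  obtain ⟨x, hx, h⟩ := exists_norm_eq_iInf_of_complete_convex hne hcl.isComplete hconv 0
  refine ⟨x, hx, fun w hw => ?_⟩
  have h1 : (⨅ w : S, ‖(0 : H) - w‖) ≤ ‖(0 : H) - w‖ :=
    ciInf_le (f := fun w : S => ‖(0 : H) - w‖)
      ⟨0, by rintro _ ⟨y, rfl⟩; exact norm_nonneg _⟩ ⟨w, hw⟩
  rw [← h] at h1
  simpa using h1

/-- A decreasing sequence of nonempty bounded closed convex subsets of a Hilbert space has
nonempty intersection. -/
lemma exists_forall_mem_of_antitone_convex {S : ℕ → Set H} (hanti : Antitone S)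
    (hne : ∀ k, (S k).Nonempty) (hcl : ∀ k, IsClosed (S k)) (hconv : ∀ k, Convex ℝ (S k))
    (hbdd : Bornology.IsBounded (S 0)) : ∃ x, ∀ k, x ∈ S k := by
  choose x hxS hxmin using fun k =>
    exists_forall_norm_le_of_isClosed_convex (hne k) (hcl k) (hconv k)
  obtain ⟨R, hR⟩ := hbdd.exists_norm_le
  have hmono : Monotone fun k => ‖x k‖ ^ 2 := fun i j hij =>
    pow_le_pow_left₀ (norm_nonneg _) (hxmin i _ (hanti hij (hxS j))) 2
  have hub : BddAbove (Set.range fun k => ‖x k‖ ^ 2) := by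
    refine ⟨R ^ 2, ?_⟩
    rintro _ ⟨k, rfl⟩
    exact pow_le_pow_left₀ (norm_nonneg _) (hR _ (hanti (Nat.zero_le k) (hxS k))) 2
  have hlim := tendsto_atTop_ciSup hmono hub
  set L := ⨆ k, ‖x k‖ ^ 2
  have hdist : ∀ i j, i ≤ j → dist (x i) (x j) ≤ √(2 * (L - ‖x i‖ ^ 2)) := by
    intro i j hij
    apply Real.le_sqrt_of_sq_le
    have hmid : (1 / 2 : ℝ) • x i + (1 / 2 : ℝ) • x j ∈ S i :=
      hconv i (hxS i) (hanti hij (hxS j)) (by norm_num) (by norm_num) (by norm_num)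
    have h1 := hxmin i _ hmid
    rw [← smul_add, norm_smul] at h1
    have h2 : 2 * ‖x i‖ ≤ ‖x i + x j‖ := by
      norm_num at h1
      linarith
    have h3 := parallelogram_law_with_norm ℝ (x i) (x j)
    have h4 : ‖x j‖ ^ 2 ≤ L := le_ciSup hub j
    have h5 := pow_le_pow_left₀ (by positivity) h2 2
    rw [dist_eq_norm]
    nlinarith
  have hto : Tendsto (fun i => √(2 * (L - ‖x i‖ ^ 2))) atTop (𝓝 0) := by
    have h := ((hlim.const_sub L).const_mul 2).sqrt
    simpa using h
  obtain ⟨y, hy⟩ := cauchySeq_tendsto_of_complete (cauchySeq_of_le_tendsto_0' _ hdist hto)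
  exact ⟨y, fun k => (hcl k).mem_of_tendsto hy
    (eventually_atTop.2 ⟨k, fun j hj => hanti hj (hxS j)⟩)⟩

lemma LowerSemicontinuousOn.isClosed_setOf_mem_and_le {α : Type*} [TopologicalSpace α]
    {K : Set α} {f : α → ℝ} (hf : LowerSemicontinuousOn f K) (hK : IsClosed K) (c : ℝ) :
    IsClosed {x | x ∈ K ∧ f x ≤ c} := by
  obtain ⟨v, hv, h⟩ := lowerSemicontinuousOn_iff_preimage_Iic.1 hf c
  change IsClosed (K ∩ f ⁻¹' Set.Iic c)
  rw [h]
  exact hK.inter hv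

/-- A convex lower semicontinuous function is bounded below on a bounded closed convex subset of a
Hilbert space. -/
lemma ConvexOn.exists_forall_le {K : Set H} {f : H → ℝ} (hf : ConvexOn ℝ K f)
    (hlsc : LowerSemicontinuousOn f K) (hK : IsClosed K) (hb : Bornology.IsBounded K) :
    ∃ c, ∀ x ∈ K, c ≤ f x := by
  by_contra! hcon
  obtain ⟨x, hx⟩ := exists_forall_mem_of_antitone_convex
    (S := fun k : ℕ => {x | x ∈ K ∧ f x ≤ -(k : ℝ)})
    (fun i j hij x hx => ⟨hx.1, hx.2.trans (neg_le_neg (Nat.cast_le.2 hij))⟩)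
    (fun k => (hcon (-(k : ℝ))).imp fun x hx => ⟨hx.1, hx.2.le⟩)
    (fun k => hlsc.isClosed_setOf_mem_and_le hK _) (fun k => hf.convex_le _)
    (hb.subset fun x hx => hx.1)
  obtain ⟨k, hk⟩ := exists_nat_gt (-f x)
  linarith [(hx k).2]

lemma ConcaveOn.exists_forall_ge {K : Set H} {f : H → ℝ} (hf : ConcaveOn ℝ K f)
    (husc : UpperSemicontinuousOn f K) (hK : IsClosed K) (hb : Bornology.IsBounded K) :
    ∃ c, ∀ x ∈ K, f x ≤ c := by
  obtain ⟨c, hc⟩ := hf.neg.exists_forall_le (lowerSemicontinuousOn_neg_iff.2 husc) hK hb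
  exact ⟨-c, fun x hx => le_neg.1 (hc x hx)⟩

/-- The image of the epigraph of a convex lower semicontinuous function on a bounded closed convex
set under a continuous linear map acting on the first factor is closed. -/
lemma ConvexOn.isClosed_image_epigraph {K : Set H} {f : H → ℝ} (hf : ConvexOn ℝ K f)
    (hlsc : LowerSemicontinuousOn f K) (hK : IsClosed K) (hb : Bornology.IsBounded K)
    (T : H →L[ℝ] E) : IsClosed {w : E × ℝ | ∃ x ∈ K, T x = w.1 ∧ f x ≤ w.2} := by
  refine isClosed_of_closure_subset fun w hw => ?_
  have hε : ∀ k : ℕ, (0 : ℝ) < 1 / (k + 1) := fun k => Nat.one_div_pos_of_nat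
  have key : ∃ x, ∀ k : ℕ, x ∈ {x | x ∈ K ∧ f x ≤ w.2 + 1 / (k + 1)} ∩
      T ⁻¹' Metric.closedBall w.1 (1 / (k + 1)) := by
    refine exists_forall_mem_of_antitone_convex ?_ ?_ ?_ ?_ ?_
    · intro i j hij x hx
      have h : (1 : ℝ) / (j + 1) ≤ 1 / (i + 1) := Nat.one_div_le_one_div hij
      exact ⟨⟨hx.1.1, hx.1.2.trans (by gcongr)⟩, Metric.closedBall_subset_closedBall h hx.2⟩
    · intro k
      obtain ⟨b, ⟨x, hxK, hTx, hfx⟩, hd⟩ := Metric.mem_closure_iff.1 hw _ (hε k)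
      rw [Prod.dist_eq, max_lt_iff] at hd
      refine ⟨x, ⟨hxK, ?_⟩, ?_⟩
      · have := (abs_lt.1 (Real.dist_eq w.2 b.2 ▸ hd.2)).1
        linarith
      · rw [Set.mem_preimage, hTx, Metric.mem_closedBall, dist_comm]
        exact hd.1.le
    · exact fun k => (hlsc.isClosed_setOf_mem_and_le hK _).inter
        (Metric.isClosed_closedBall.preimage T.continuous)
    · exact fun k => (hf.convex_le _).inter
        ((convex_closedBall _ _).linear_preimage T.toLinearMap)
    · exact hb.subset fun x hx => hx.1.1
  obtain ⟨x, hx⟩ := key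
  refine ⟨x, (hx 0).1.1, ?_, ?_⟩
  · rw [← dist_le_zero]
    exact ge_of_tendsto' tendsto_one_div_add_atTop_nhds_zero_nat fun k => (hx k).2
  · have h := tendsto_one_div_add_atTop_nhds_zero_nat (𝕜 := ℝ).const_add w.2
    rw [add_zero] at h
    exact ge_of_tendsto' h fun k => (hx k).1.2

/-- Strong Lagrange duality for a linear equality constraint. -/
lemma ConvexOn.exists_lagrange_multiplier [CompleteSpace E] {K : Set H} {f : H → ℝ}
    (hf : ConvexOn ℝ K f)
    (hlsc : LowerSemicontinuousOn f K) (hK : IsClosed K) (hb : Bornology.IsBounded K)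
    (T : H →L[ℝ] E) {z : E} {x₀ : H} (hx₀ : x₀ ∈ K) (hTx₀ : T x₀ = z) {c : ℝ}
    (hc : ∀ x ∈ K, T x = z → c < f x) : ∃ μ : E, ∀ x ∈ K, c ≤ f x + ⟪μ, T x - z⟫ := by
  have hconv : Convex ℝ {w : E × ℝ | ∃ x ∈ K, T x = w.1 ∧ f x ≤ w.2} := by
    rintro w ⟨x, hx, hTx, hfx⟩ w' ⟨x', hx', hTx', hfx'⟩ a b ha hb hab
    refine ⟨a • x + b • x', hf.1 hx hx' ha hb hab, by simp [hTx, hTx'],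
      (hf.2 hx hx' ha hb hab).trans ?_⟩
    simp only [smul_eq_mul, Prod.snd_add, Prod.smul_snd]
    gcongr
  obtain ⟨g, α, hlt, hgt⟩ := geometric_hahn_banach_point_closed hconv
    (hf.isClosed_image_epigraph hlsc hK hb T) (x := (z, c))
    (fun ⟨x, hx, hTx, hfx⟩ => (hc x hx hTx).not_ge hfx)
  set s := g (0, 1) with hs
  have hg : ∀ (y : E) (r : ℝ), g (y, r) = g (y, 0) + r * s := by
    intro y r
    have : ((y, r) : E × ℝ) = (y, 0) + r • ((0, 1) : E × ℝ) := by simp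
    rw [this, map_add, map_smul, smul_eq_mul]
  have hspos : 0 < s := by
    have h1 := hgt (z, f x₀) ⟨x₀, hx₀, hTx₀, le_rfl⟩
    rw [hg] at h1 hlt
    have h2 := hc x₀ hx₀ hTx₀
    nlinarith
  refine ⟨(InnerProductSpace.toDual ℝ E).symm (s⁻¹ • g.comp (.inl ℝ E ℝ)), fun x hx => ?_⟩
  rw [InnerProductSpace.toDual_symm_apply]
  have h1 := hlt.trans (hgt (T x, f x) ⟨x, hx, rfl, le_rfl⟩)
  rw [hg, hg (T x)] at h1
  have h2 : g (T x - z, 0) = g (T x, 0) - g (z, 0) := by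
    rw [← map_sub]
    simp
  simp only [smul_apply, ContinuousLinearMap.comp_apply,
    ContinuousLinearMap.inl_apply, h2, smul_eq_mul]
  rw [← sub_nonneg]
  have h3 : f x + s⁻¹ * (g (T x, 0) - g (z, 0)) - c =
      s⁻¹ * ((g (T x, 0) + f x * s) - (g (z, 0) + c * s)) := by
    field_simp
    ring
  rw [h3]
  exact mul_nonneg (inv_nonneg.2 hspos.le) (sub_nonneg.2 h1.le)

end ConvexHilbert

section Duality

open Filter Topology

variable {H₁ H₂ E₁ E₂ : Type*}
  [NormedAddCommGroup H₁] [InnerProductSpace ℝ H₁] [CompleteSpace H₁]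
  [NormedAddCommGroup H₂] [InnerProductSpace ℝ H₂] [CompleteSpace H₂]
  [NormedAddCommGroup E₁] [InnerProductSpace ℝ E₁] [CompleteSpace E₁]
  [NormedAddCommGroup E₂] [InnerProductSpace ℝ E₂] [CompleteSpace E₂]

/-- Lagrange duality for the splitting `x = x₀ + B u` of a sum of two convex functions. -/
lemma exists_split_lagrange_multiplier {U : Set H₁} {X : Set E₁} {a : H₁ → ℝ} {b : E₁ → ℝ}
    (ha : ConvexOn ℝ U a) (hal : LowerSemicontinuousOn a U) (hU : IsClosed U)
    (hUb : Bornology.IsBounded U) (hUne : U.Nonempty)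
    (hb : ConvexOn ℝ X b) (hbl : LowerSemicontinuousOn b X) (hX : IsClosed X)
    (hXb : Bornology.IsBounded X) (B : H₁ →L[ℝ] E₁) (x₀ : E₁)
    (hreach : ∀ u ∈ U, x₀ + B u ∈ X) {c : ℝ} (hc : ∀ u ∈ U, c < a u + b (x₀ + B u)) :
    ∃ μ : E₁, ∀ u ∈ U, ∀ x ∈ X, c ≤ (a u - ⟪μ, B u⟫) + (b x + ⟪μ, x⟫) - ⟪μ, x₀⟫ := by
  obtain ⟨u₀, hu₀⟩ := hUne
  let K : Set (WithLp 2 (H₁ × E₁)) := {k | k.fst ∈ U ∧ k.snd ∈ X}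
  have hf1 : Continuous (WithLp.fst : WithLp 2 (H₁ × E₁) → H₁) := WithLp.continuous_fst 2 H₁ E₁
  have hf2 : Continuous (WithLp.snd : WithLp 2 (H₁ × E₁) → E₁) := WithLp.continuous_snd 2 H₁ E₁
  have hconv : ConvexOn ℝ K (fun k => a k.fst + b k.snd) :=
    ((ha.comp_linearMap (WithLp.fstL 2 ℝ H₁ E₁).toLinearMap).subset (fun k hk => hk.1)
      ((ha.1.linear_preimage (WithLp.fstL 2 ℝ H₁ E₁).toLinearMap).inter
        (hb.1.linear_preimage (WithLp.sndL 2 ℝ H₁ E₁).toLinearMap))).add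
      ((hb.comp_linearMap (WithLp.sndL 2 ℝ H₁ E₁).toLinearMap).subset (fun k hk => hk.2)
      ((ha.1.linear_preimage (WithLp.fstL 2 ℝ H₁ E₁).toLinearMap).inter
        (hb.1.linear_preimage (WithLp.sndL 2 ℝ H₁ E₁).toLinearMap)))
  have hlsc : LowerSemicontinuousOn (fun k => a k.fst + b k.snd) K :=
    (hal.comp hf1.continuousOn fun k hk => hk.1).add (hbl.comp hf2.continuousOn fun k hk => hk.2)
  have hbdd : Bornology.IsBounded K := by
    obtain ⟨R, hR⟩ := hUb.exists_norm_le
    obtain ⟨R', hR'⟩ := hXb.exists_norm_le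
    refine isBounded_iff_forall_norm_le.2 ⟨√(R ^ 2 + R' ^ 2), fun k hk => ?_⟩
    apply Real.le_sqrt_of_sq_le
    rw [WithLp.prod_norm_sq_eq_of_L2]
    gcongr
    · exact hR _ hk.1
    · exact hR' _ hk.2
  obtain ⟨μ, hμ⟩ := hconv.exists_lagrange_multiplier hlsc
    ((hU.preimage hf1).inter (hX.preimage hf2)) hbdd
    (WithLp.sndL 2 ℝ H₁ E₁ - B ∘L WithLp.fstL 2 ℝ H₁ E₁) (z := x₀)
    (x₀ := WithLp.toLp 2 (u₀, x₀ + B u₀)) ⟨hu₀, hreach u₀ hu₀⟩ (by simp) (c := c) (by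
      rintro k ⟨hk1, hk2⟩ hk
      have : k.snd = x₀ + B k.fst := sub_eq_iff_eq_add.1 hk
      rw [this]
      exact hc _ hk1)
  refine ⟨μ, fun u hu x hx => (hμ (WithLp.toLp 2 (u, x)) ⟨hu, hx⟩).trans_eq ?_⟩
  simp [inner_sub_right]
  ring

/-- The infimum of `a u + b (x₀ + B u)` is the supremum of the Lagrange dual function obtained by
splitting off the variable `x = x₀ + B u`. -/
lemma isLUB_split_dual {U : Set H₁} {X : Set E₁} {a : H₁ → ℝ} {b : E₁ → ℝ}
    (ha : ConvexOn ℝ U a) (hal : LowerSemicontinuousOn a U) (hU : IsClosed U)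
    (hUb : Bornology.IsBounded U) (hUne : U.Nonempty)
    (hb : ConvexOn ℝ X b) (hbl : LowerSemicontinuousOn b X) (hX : IsClosed X)
    (hXb : Bornology.IsBounded X) (B : H₁ →L[ℝ] E₁) (x₀ : E₁)
    (hreach : ∀ u ∈ U, x₀ + B u ∈ X) :
    IsLUB (Set.range fun μ : E₁ =>
      (⨅ u : U, (a u - ⟪μ, B u⟫)) + (⨅ x : X, (b x + ⟪μ, (x : E₁)⟫)) - ⟪μ, x₀⟫)
      (⨅ u : U, (a u + b (x₀ + B u))) := by
  obtain ⟨ca, hca⟩ := ha.exists_forall_le hal hU hUb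
  obtain ⟨cb, hcb⟩ := hb.exists_forall_le hbl hX hXb
  have : Nonempty U := hUne.to_subtype
  obtain ⟨u₀, hu₀⟩ := hUne
  have : Nonempty X := ⟨⟨_, hreach u₀ hu₀⟩⟩
  obtain ⟨R, hR⟩ := hUb.exists_norm_le
  obtain ⟨R', hR'⟩ := hXb.exists_norm_le
  refine ⟨?_, fun M hM => ?_⟩
  · rintro _ ⟨μ, rfl⟩
    refine le_ciInf fun u => ?_
    have h1 : (⨅ u : U, (a u - ⟪μ, B u⟫)) ≤ a u - ⟪μ, B u⟫ := by
      refine ciInf_le ⟨ca - ‖μ‖ * (‖B‖ * R), ?_⟩ u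
      rintro _ ⟨v, rfl⟩
      refine sub_le_sub (hca v v.2) ((real_inner_le_norm _ _).trans ?_)
      gcongr
      exact B.le_opNorm_of_le (hR v v.2)
    have h2 : (⨅ x : X, (b x + ⟪μ, (x : E₁)⟫)) ≤ b (x₀ + B u) + ⟪μ, x₀ + B u⟫ := by
      refine ciInf_le (f := fun x : X => b x + ⟪μ, (x : E₁)⟫) ⟨cb + -(‖μ‖ * R'), ?_⟩
        ⟨_, hreach u u.2⟩
      rintro _ ⟨x, rfl⟩
      refine add_le_add (hcb x x.2) ((neg_le_neg ?_).trans
        (neg_le_of_abs_le (abs_real_inner_le_norm _ _)))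
      gcongr
      exact hR' x x.2
    rw [inner_add_right] at h2
    simp only
    linarith
  · refine le_of_forall_lt fun c hc => ?_
    obtain ⟨c', hcc', hc'⟩ := exists_between hc
    obtain ⟨μ, hμ⟩ := exists_split_lagrange_multiplier ha hal hU hUb ⟨u₀, hu₀⟩ hb hbl hX hXb B x₀
      hreach (c := c') fun u hu => hc'.trans_le <| by
        refine ciInf_le (f := fun u : U => a u + b (x₀ + B u)) ⟨ca + cb, ?_⟩ ⟨u, hu⟩
        rintro _ ⟨v, rfl⟩
        exact add_le_add (hca v v.2) (hcb _ (hreach v v.2))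
    refine hcc'.trans_le (le_trans ?_ (hM ⟨μ, rfl⟩))
    rw [le_sub_iff_add_le]
    refine le_ciInf_add_ciInf fun u x => ?_
    linarith [hμ u u.2 x x.2]

/-- A supremum of convex functions that is finite on a set is convex on that set. -/
lemma convexOn_ciSup {ι H : Type*} [Nonempty ι] [AddCommGroup H] [Module ℝ H] {K : Set H}
    {f : ι → H → ℝ} (hf : ∀ i, ConvexOn ℝ K (f i))
    (hbdd : ∀ x ∈ K, BddAbove (Set.range fun i => f i x)) :
    ConvexOn ℝ K (fun x => ⨆ i, f i x) := by
  refine ⟨(hf (Classical.arbitrary ι)).1, fun x hx y hy s t hs ht hst => ciSup_le fun i => ?_⟩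
  refine ((hf i).2 hx hy hs ht hst).trans ?_
  simp only [smul_eq_mul]
  gcongr
  · exact le_ciSup (hbdd x hx) i
  · exact le_ciSup (hbdd y hy) i

lemma ConcaveOn.bddAbove_range_add {V : Set H₂} {g : H₂ → ℝ} (hg : ConcaveOn ℝ V g)
    (hgu : UpperSemicontinuousOn g V) (hV : IsClosed V) (hVb : Bornology.IsBounded V)
    (l : H₂ →L[ℝ] ℝ) : BddAbove (Set.range fun v : V => g v + l v) := by
  obtain ⟨c, hc⟩ := (hg.add (l.toLinearMap.concaveOn hg.1)).exists_forall_ge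
    (hgu.add (l.continuous.upperSemicontinuous.upperSemicontinuousOn V)) hV hVb
  refine ⟨c, ?_⟩
  rintro _ ⟨v, rfl⟩
  exact hc v v.2

lemma iInf_neg_eq_neg_iSup {ι : Type*} (f : ι → ℝ) : ⨅ i, -f i = -⨆ i, f i := by
  rw [iInf, iSup, Real.sInf_def]
  congr 2
  ext r
  simp [neg_eq_iff_eq_neg, eq_comm]

lemma ciInf_comm_of_forall_le {ι κ : Type*} [Nonempty ι] [Nonempty κ] {G : ι → κ → ℝ} {c : ℝ}
    (hG : ∀ i k, c ≤ G i k) : ⨅ i, ⨅ k, G i k = ⨅ k, ⨅ i, G i k := by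
  have h1 : ∀ i, BddBelow (Set.range fun k => G i k) := fun i =>
    ⟨c, by rintro _ ⟨k, rfl⟩; exact hG i k⟩
  have h2 : ∀ k, BddBelow (Set.range fun i => G i k) := fun k =>
    ⟨c, by rintro _ ⟨i, rfl⟩; exact hG i k⟩
  apply le_antisymm
  · refine le_ciInf fun k => le_ciInf fun i => ?_
    exact ciInf_le_of_le ⟨c, by rintro _ ⟨i, rfl⟩; exact le_ciInf (hG i)⟩ i (ciInf_le (h1 i) k)
  · refine le_ciInf fun i => le_ciInf fun k => ?_
    exact ciInf_le_of_le ⟨c, by rintro _ ⟨k, rfl⟩; exact le_ciInf fun i => hG i k⟩ k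
      (ciInf_le (h2 k) i)

/-- The value of a convex-concave game with linear state constraints equals the value of the
conjugate game in the multipliers of these constraints. -/
theorem minimax_eq_conjugate_minimax {U : Set H₁} {V : Set H₂} {X : Set E₁} {Y : Set E₂}
    (hU : IsClosed U) (hUb : Bornology.IsBounded U) (hUne : U.Nonempty)
    (hV : IsClosed V) (hVb : Bornology.IsBounded V) (hVne : V.Nonempty)
    (hX : IsClosed X) (hXb : Bornology.IsBounded X)
    (hY : IsClosed Y) (hYb : Bornology.IsBounded Y)
    {F : H₁ → H₂ → ℝ}
    (hFconv : ∀ v ∈ V, ConvexOn ℝ U (fun u => F u v))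
    (hFlsc : ∀ v ∈ V, LowerSemicontinuousOn (fun u => F u v) U)
    (hFconc : ∀ u ∈ U, ConcaveOn ℝ V (fun v => F u v))
    (hFusc : ∀ u ∈ U, UpperSemicontinuousOn (fun v => F u v) V)
    {Φ : E₁ → E₂ → ℝ}
    (hΦconv : ∀ y ∈ Y, ConvexOn ℝ X (fun x => Φ x y))
    (hΦlsc : ∀ y ∈ Y, LowerSemicontinuousOn (fun x => Φ x y) X)
    (hΦconc : ∀ x ∈ X, ConcaveOn ℝ Y (fun y => Φ x y))
    (hΦusc : ∀ x ∈ X, UpperSemicontinuousOn (fun y => Φ x y) Y)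
    (B : H₁ →L[ℝ] E₁) (C : H₂ →L[ℝ] E₂) (x₀ : E₁) (y₀ : E₂)
    (hXreach : ∀ u ∈ U, x₀ + B u ∈ X) (hYreach : ∀ v ∈ V, y₀ + C v ∈ Y) :
    (⨅ u : U, ⨆ v : V, (F u v + Φ (x₀ + B u) (y₀ + C v))) =
      ⨅ lam : E₂, ⨆ mu : E₁,
        ((⨅ u : U, ⨆ v : V, (F u v - ⟪mu, B u⟫ + ⟪lam, C v⟫))
          + (⨅ x : X, ⨆ y : Y, (Φ x y + ⟪mu, (x : E₁)⟫ - ⟪lam, (y : E₂)⟫))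
          - ⟪mu, x₀⟫ + ⟪lam, y₀⟫) := by
  have : Nonempty U := hUne.to_subtype
  have : Nonempty V := hVne.to_subtype
  obtain ⟨u₀, hu₀⟩ := id hUne
  obtain ⟨v₀, hv₀⟩ := id hVne
  have : Nonempty X := ⟨⟨_, hXreach u₀ hu₀⟩⟩
  have : Nonempty Y := ⟨⟨_, hYreach v₀ hv₀⟩⟩
  let a : E₂ → H₁ → ℝ := fun lam u => ⨆ v : V, (F u v + ⟪lam, C v⟫)
  let b : E₂ → E₁ → ℝ := fun lam x => ⨆ y : Y, (Φ x y - ⟪lam, (y : E₂)⟫)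
  have hbdda : ∀ lam, ∀ u ∈ U, BddAbove (Set.range fun v : V => F u v + ⟪lam, C v⟫) :=
    fun lam u hu => (hFconc u hu).bddAbove_range_add (hFusc u hu) hV hVb (innerSL ℝ lam ∘L C)
  have hbddb : ∀ lam, ∀ x ∈ X, BddAbove (Set.range fun y : Y => Φ x y - ⟪lam, (y : E₂)⟫) := by
    intro lam x hx
    simpa [sub_eq_add_neg] using
      (hΦconc x hx).bddAbove_range_add (hΦusc x hx) hY hYb (-innerSL ℝ lam)
  have haconv : ∀ lam, ConvexOn ℝ U (a lam) := fun lam =>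
    convexOn_ciSup (fun v : V => (hFconv v v.2).add_const _) (hbdda lam)
  have hbconv : ∀ lam, ConvexOn ℝ X (b lam) := fun lam =>
    convexOn_ciSup (fun y : Y => (hΦconv y y.2).sub (concaveOn_const _ (hΦconv y y.2).1))
      (hbddb lam)
  have halsc : ∀ lam, LowerSemicontinuousOn (a lam) U := fun lam =>
    lowerSemicontinuousOn_ciSup (hbdda lam) fun v =>
      (hFlsc v v.2).add lowerSemicontinuousOn_const
  have hblsc : ∀ lam, LowerSemicontinuousOn (b lam) X := fun lam =>
    lowerSemicontinuousOn_ciSup (hbddb lam) fun y => by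
      simpa only [sub_eq_add_neg] using
        (hΦlsc y y.2).add (lowerSemicontinuousOn_const (z := -⟪lam, (y : E₂)⟫))
  obtain ⟨cF, hcF⟩ := (hFconv v₀ hv₀).exists_forall_le (hFlsc v₀ hv₀) hU hUb
  obtain ⟨cΦ, hcΦ⟩ :=
    (hΦconv _ (hYreach v₀ hv₀)).exists_forall_le (hΦlsc _ (hYreach v₀ hv₀)) hX hXb
  have hlower : ∀ (u : U) lam, cF + cΦ ≤ a lam u + b lam (x₀ + B u) + ⟪lam, y₀⟫ := by
    intro u lam
    have h1 : F u v₀ + ⟪lam, C v₀⟫ ≤ a lam u := le_ciSup (hbdda lam u u.2) ⟨v₀, hv₀⟩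
    have h2 : Φ (x₀ + B u) (y₀ + C v₀) - ⟪lam, y₀ + C v₀⟫ ≤ b lam (x₀ + B u) :=
      le_ciSup (hbddb lam _ (hXreach u u.2)) ⟨_, hYreach v₀ hv₀⟩
    rw [inner_add_right] at h2
    linarith [hcF u u.2, hcΦ _ (hXreach u u.2)]
  have hdual_u : ∀ lam : E₂, (⨆ mu : E₁,
        ((⨅ u : U, ⨆ v : V, (F u v - ⟪mu, B u⟫ + ⟪lam, C v⟫))
          + (⨅ x : X, ⨆ y : Y, (Φ x y + ⟪mu, (x : E₁)⟫ - ⟪lam, (y : E₂)⟫))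
          - ⟪mu, x₀⟫ + ⟪lam, y₀⟫)) = ⨅ u : U, (a lam u + b lam (x₀ + B u) + ⟪lam, y₀⟫) := by
    intro lam
    have hlub := isLUB_split_dual (haconv lam) (halsc lam) hU hUb hUne (hbconv lam) (hblsc lam)
      hX hXb B x₀ hXreach
    have hbelow : BddBelow (Set.range fun u : U => a lam u + b lam (x₀ + B u)) := by
      refine ⟨cF + cΦ - ⟪lam, y₀⟫, ?_⟩
      rintro _ ⟨u, rfl⟩
      exact sub_le_iff_le_add.2 (hlower u lam)
    rw [← ciInf_add hbelow, ← hlub.csSup_eq (Set.range_nonempty _), ← iSup,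
      ciSup_add hlub.bddAbove]
    congr 1 with mu
    congr 3
    · congr 1 with u
      rw [ciSup_sub (hbdda lam u u.2)]
      congr 1 with v
      ring
    · congr 1 with x
      rw [ciSup_add (hbddb lam x x.2)]
      congr 1 with y
      ring
  have hdual_v : ∀ u : U, (⨅ lam : E₂, (a lam u + b lam (x₀ + B u) + ⟪lam, y₀⟫)) =
      ⨆ v : V, (F u v + Φ (x₀ + B u) (y₀ + C v)) := by
    intro u
    have hx := hXreach u u.2
    have hlub := isLUB_split_dual (hFconc u u.2).neg
      (lowerSemicontinuousOn_neg_iff.2 (hFusc u u.2)) hV hVb hVne (hΦconc _ hx).neg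
      (lowerSemicontinuousOn_neg_iff.2 (hΦusc _ hx)) hY hYb C y₀ hYreach
    have h := hlub.csSup_eq (Set.range_nonempty _)
    rw [← neg_inj, ← iInf_neg_eq_neg_iSup]
    rw [← iSup] at h
    trans ⨆ lam : E₂, -(a lam u + b lam (x₀ + B u) + ⟪lam, y₀⟫)
    · have h' := iInf_neg_eq_neg_iSup fun lam : E₂ => -(a lam u + b lam (x₀ + B u) + ⟪lam, y₀⟫)
      simp only [neg_neg] at h'
      rw [h', neg_neg]
    · refine (iSup_congr fun lam => ?_).trans (h.trans (iInf_congr fun v => ?_))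
      · simp only [a, b, neg_add, ← iInf_neg_eq_neg_iSup, Pi.neg_apply, sub_eq_add_neg, neg_neg]
      · exact (neg_add _ _).symm
  simp_rw [hdual_u, ← hdual_v]
  exact ciInf_comm_of_forall_le hlower

end Duality

section PointwiseConstraint

open Filter Topology

variable {α E : Type*} [MeasurableSpace α] {μ : Measure α} [NormedAddCommGroup E]
  {r : ENNReal} {s : Set E}

lemma isClosed_setOf_ae_mem_Lp [Fact (1 ≤ r)] (hs : IsClosed s) :
    IsClosed {u : Lp E r μ | ∀ᵐ t ∂μ, u t ∈ s} := by
  refine IsSeqClosed.isClosed fun u v hu huv => ?_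
  obtain ⟨ns, -, h⟩ := (tendstoInMeasure_of_tendsto_Lp huv).exists_seq_tendsto_ae
  filter_upwards [h, ae_all_iff.2 fun k => hu (ns k)] with t ht hut
  exact hs.mem_of_tendsto ht (Eventually.of_forall hut)

lemma isBounded_setOf_ae_mem_Lp [IsFiniteMeasure μ] [Fact (1 ≤ r)] (hs : Bornology.IsBounded s) :
    Bornology.IsBounded {u : Lp E r μ | ∀ᵐ t ∂μ, u t ∈ s} := by
  obtain ⟨R, hR⟩ := hs.exists_norm_le
  refine isBounded_iff_forall_norm_le.2 ⟨_, fun u hu =>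
    Lp.norm_le_of_ae_bound (le_max_right R 0) ?_⟩
  filter_upwards [hu] with t ht
  exact (hR _ ht).trans (le_max_left _ _)

lemma nonempty_setOf_ae_mem_Lp [IsFiniteMeasure μ] (hs : s.Nonempty) :
    {u : Lp E r μ | ∀ᵐ t ∂μ, u t ∈ s}.Nonempty := by
  obtain ⟨c, hc⟩ := hs
  refine ⟨Lp.const r μ c, ?_⟩
  filter_upwards [Lp.coeFn_const r μ c] with t ht
  rw [ht]
  exact hc

end PointwiseConstraint

/-- Lemma 3 (Dvurechensky–Nesterov–Spokoiny, JOTA 2015): under boundedness, convexity and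
semicontinuity assumptions, the constrained infinite-dimensional saddle-point problem of a
linear differential game is equivalent to the finite-dimensional conjugate problem: the two
optimal values coincide. -/
theorem game_conjugate_problem_equivalence
    -- time horizon and the restricted Lebesgue measure on [0, θ]
    (θ : ℝ) (hθ : 0 < θ)
    (μt : Measure ℝ) (hμt : μt = volume.restrict (Set.Icc (0 : ℝ) θ))
    -- dimensions
    (p q n mdim : ℕ)
    -- pointwise control constraint sets: convex, closed, bounded, nonempty
    (Pset : Set (EuclideanSpace ℝ (Fin p))) (Qset : Set (EuclideanSpace ℝ (Fin q)))
    (hPconv : Convex ℝ Pset) (hPclosed : IsClosed Pset)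
    (hPbdd : Bornology.IsBounded Pset) (hPne : Pset.Nonempty)
    (hQconv : Convex ℝ Qset) (hQclosed : IsClosed Qset)
    (hQbdd : Bornology.IsBounded Qset) (hQne : Qset.Nonempty)
    -- admissible control sets in L²([0,θ])
    (𝒰 : Set (Lp (EuclideanSpace ℝ (Fin p)) 2 μt))
    (𝒱 : Set (Lp (EuclideanSpace ℝ (Fin q)) 2 μt))
    (h𝒰 : 𝒰 = {u : Lp (EuclideanSpace ℝ (Fin p)) 2 μt | ∀ᵐ t ∂μt, (u : ℝ → EuclideanSpace ℝ (Fin p)) t ∈ Pset})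
    (h𝒱 : 𝒱 = {v : Lp (EuclideanSpace ℝ (Fin q)) 2 μt | ∀ᵐ t ∂μt, (v : ℝ → EuclideanSpace ℝ (Fin q)) t ∈ Qset})
    -- the bounded linear operators mapping controls to terminal states,
    -- and the free terminal states
    (𝓑 : Lp (EuclideanSpace ℝ (Fin p)) 2 μt →L[ℝ] EuclideanSpace ℝ (Fin n))
    (𝓒 : Lp (EuclideanSpace ℝ (Fin q)) 2 μt →L[ℝ] EuclideanSpace ℝ (Fin mdim))
    (xt₀ : EuclideanSpace ℝ (Fin n)) (yt₀ : EuclideanSpace ℝ (Fin mdim))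
    -- the running cost F : convex and lsc in u, concave and usc in v
    (F : Lp (EuclideanSpace ℝ (Fin p)) 2 μt → Lp (EuclideanSpace ℝ (Fin q)) 2 μt → ℝ)
    (hFconv : ∀ v ∈ 𝒱, ConvexOn ℝ 𝒰 (fun u => F u v))
    (hFlsc : ∀ v ∈ 𝒱, LowerSemicontinuousOn (fun u => F u v) 𝒰)
    (hFconc : ∀ u ∈ 𝒰, ConcaveOn ℝ 𝒱 (fun v => F u v))
    (hFusc : ∀ u ∈ 𝒰, UpperSemicontinuousOn (fun v => F u v) 𝒱)
    -- the terminal cost Φ : continuous, convex in x, concave in y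
    (Φ : EuclideanSpace ℝ (Fin n) → EuclideanSpace ℝ (Fin mdim) → ℝ)
    (hΦcont : Continuous (Function.uncurry Φ))
    (hΦconv : ∀ y, ConvexOn ℝ Set.univ (fun x => Φ x y))
    (hΦconc : ∀ x, ConcaveOn ℝ Set.univ (fun y => Φ x y))
    -- the terminal-state sets: closed, convex, bounded, containing the reachable states
    (X : Set (EuclideanSpace ℝ (Fin n))) (Y : Set (EuclideanSpace ℝ (Fin mdim)))
    (hXconv : Convex ℝ X) (hXclosed : IsClosed X) (hXbdd : Bornology.IsBounded X)
    (hYconv : Convex ℝ Y) (hYclosed : IsClosed Y) (hYbdd : Bornology.IsBounded Y)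
    (hXreach : ∀ u ∈ 𝒰, xt₀ + 𝓑 u ∈ X) (hYreach : ∀ v ∈ 𝒱, yt₀ + 𝓒 v ∈ Y) :
    (⨅ w : {w : Lp (EuclideanSpace ℝ (Fin p)) 2 μt × EuclideanSpace ℝ (Fin n) //
        w.1 ∈ 𝒰 ∧ w.2 ∈ X ∧ w.2 = xt₀ + 𝓑 w.1},
      ⨆ z : {z : Lp (EuclideanSpace ℝ (Fin q)) 2 μt × EuclideanSpace ℝ (Fin mdim) //
        z.1 ∈ 𝒱 ∧ z.2 ∈ Y ∧ z.2 = yt₀ + 𝓒 z.1},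
        (F w.1.1 z.1.1 + Φ w.1.2 z.1.2))
    = ⨅ lam : EuclideanSpace ℝ (Fin mdim), ⨆ muv : EuclideanSpace ℝ (Fin n),
        ((⨅ u : 𝒰, ⨆ v : 𝒱, (F u.1 v.1 - ⟪muv, 𝓑 u.1⟫ + ⟪lam, 𝓒 v.1⟫))
          + (⨅ x : X, ⨆ y : Y, (Φ x.1 y.1 + ⟪muv, x.1⟫ - ⟪lam, y.1⟫))
          - ⟪muv, xt₀⟫ + ⟪lam, yt₀⟫) := by
  subst hμt h𝒰 h𝒱
  have hΦx : ∀ y, Continuous fun x => Φ x y := fun y => hΦcont.comp (.prodMk_left y)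
  have hΦy : ∀ x, Continuous fun y => Φ x y := fun x => hΦcont.comp (.prodMk_right x)
  rw [← minimax_eq_conjugate_minimax (isClosed_setOf_ae_mem_Lp hPclosed)
    (isBounded_setOf_ae_mem_Lp hPbdd) (nonempty_setOf_ae_mem_Lp hPne)
    (isClosed_setOf_ae_mem_Lp hQclosed) (isBounded_setOf_ae_mem_Lp hQbdd)
    (nonempty_setOf_ae_mem_Lp hQne) hXclosed hXbdd hYclosed hYbdd hFconv hFlsc hFconc hFusc
    (fun y _ => (hΦconv y).subset (Set.subset_univ X) hXconv)
    (fun y _ => (hΦx y).lowerSemicontinuous.lowerSemicontinuousOn X)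
    (fun x _ => (hΦconc x).subset (Set.subset_univ Y) hYconv)
    (fun x _ => (hΦy x).upperSemicontinuous.upperSemicontinuousOn Y) 𝓑 𝓒 xt₀ yt₀ hXreach hYreach]
  refine Function.Surjective.iInf_congr (fun w => ⟨w.1.1, w.2.1⟩)
    (fun u => ⟨⟨(u.1, xt₀ + 𝓑 u.1), u.2, hXreach u.1 u.2, rfl⟩, rfl⟩) fun w => ?_
  refine (Function.Surjective.iSup_congr (fun z => ⟨z.1.1, z.2.1⟩)
    (fun v => ⟨⟨(v.1, yt₀ + 𝓒 v.1), v.2, hYreach v.1 v.2, rfl⟩, rfl⟩) fun z => ?_).symm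
  simp only [w.2.2.2, z.2.2.2]
end

section
/- Let the dual objective φ(λ) = ⟨λ, b⟩ + max_{x∈Q}(−f(x) − ⟨𝐀ᵀλ, x⟩) have a ν-Hölder-continuous subgradient, ‖∇φ(λ) − ∇φ(μ)‖_* ≤ M_ν‖λ − μ‖^ν for some ν ∈ [0,1], and have a solution λ* with ‖λ*‖₂ ≤ R. Then, for the sequences x̂^{k+1}, η^{k+1} generated by the primal-dual universal gradient method with small-dimensional relaxation (PDUGDsDR, Algorithm 12) with accuracy parameter ε, one has for all k ≥ 1: ‖𝐀x̂^k − b‖₂ ≤ 2R/A_k + ε/(2R) and |φ(η^k) + f(x̂^k)| ≤ 2R²/A_k + ε/2, where A_k ≥ [(1+ν)/(1−ν)]^{(1−ν)/(1+ν)} · k^{(1+3ν)/(1+ν)} ε^{(1−ν)/(1+ν)} / (2^{(1+3ν)/(1+ν)} M_ν^{2/(1+ν)}). -/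
set_option autoImplicit false

open RealInnerProductSpace Finset

/-- The tangent-line inequality for `t ↦ t ^ (1 + ν)` on the nonnegative reals. -/
lemma rpow_one_add_tangent_le {ν s t : ℝ} (hν : 0 ≤ ν) (hs : 0 ≤ s) (hst : s ≤ t) :
    (t - s) * s ^ ν ≤ (t ^ (1 + ν) - s ^ (1 + ν)) / (1 + ν) := by
  have hν1 : 0 < 1 + ν := by linarith
  rw [le_div_iff₀ hν1]
  rcases hs.eq_or_lt with rfl | hs
  · rw [Real.zero_rpow hν1.ne']
    rcases hν.eq_or_lt with rfl | hν
    · simp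
    · rw [Real.zero_rpow hν.ne']
      have := Real.rpow_nonneg hst (1 + ν)
      simpa using this
  · have hB := one_add_mul_self_le_rpow_one_add (s := (t - s) / s) (p := 1 + ν)
      (by have : 0 ≤ (t - s) / s := div_nonneg (by linarith) hs.le
          linarith) (by linarith)
    have ht : t = s * (1 + (t - s) / s) := by field_simp; ring
    have hpow : t ^ (1 + ν) = s ^ (1 + ν) * (1 + (t - s) / s) ^ (1 + ν) := by
      conv_lhs => rw [ht]
      exact Real.mul_rpow hs.le
        (by have : 0 ≤ (t - s) / s := div_nonneg (by linarith) hs.le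
            linarith)
    have hs1 : s ^ (1 + ν) = s * s ^ ν := by rw [Real.rpow_add hs, Real.rpow_one]
    have hmul := mul_le_mul_of_nonneg_left hB (Real.rpow_nonneg hs.le (1 + ν))
    rw [← hpow] at hmul
    have : s ^ (1 + ν) * (1 + (1 + ν) * ((t - s) / s))
        = s ^ (1 + ν) + (t - s) * s ^ ν * (1 + ν) := by
      rw [hs1]; field_simp
    linarith

/-- A function on `[0, 1]` whose increments are bounded by those of `C * t ^ (1 + ν) / (1 + ν)`,
up to using the right-endpoint slope, satisfies the integrated bound. -/
lemma sub_le_of_increment_le_rpow {ν C : ℝ} (hν : 0 ≤ ν) (hC : 0 ≤ C) {u : ℝ → ℝ}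
    (hu : ∀ s t, 0 ≤ s → s ≤ t → u t - u s ≤ (t - s) * (C * t ^ ν)) :
    u 1 - u 0 ≤ C / (1 + ν) := by
  have hν1 : 0 < 1 + ν := by linarith
  have hn : ∀ n : ℕ, 0 < n → u 1 - u 0 ≤ C / (1 + ν) + C * (1 / n) := by
    intro n hn
    have hn' : (0 : ℝ) < n := by exact_mod_cast hn
    have hstep : ∀ i : ℕ, i ≤ n → u (i / n) - u 0
        ≤ C * ((i / n : ℝ) ^ (1 + ν) / (1 + ν)) + C * (1 / n) * (i / n : ℝ) ^ ν := by
      intro i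
      induction i with
      | zero =>
        intro _
        have h0 : (0 : ℝ) ≤ C * (1 / n) * (0 : ℝ) ^ ν := by positivity
        simpa [Real.zero_rpow hν1.ne'] using h0
      | succ i ih =>
        intro hi
        have h1 := ih (by omega)
        have hs : (0 : ℝ) ≤ i / n := by positivity
        have hdiff : (((i + 1 : ℕ) : ℝ) / n) - i / n = 1 / n := by
          push_cast; field_simp; ring
        have hst : (i / n : ℝ) ≤ ((i + 1 : ℕ) : ℝ) / n := by
          have : (0 : ℝ) ≤ 1 / n := by positivity
          linarith
        have h2 := hu _ _ hs hst
        have h3 := mul_le_mul_of_nonneg_left (rpow_one_add_tangent_le hν hs hst) hC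
        rw [hdiff] at h2 h3
        rw [sub_div] at h3
        nlinarith
    have := hstep n le_rfl
    rw [div_self hn'.ne', Real.one_rpow, Real.one_rpow] at this
    calc u 1 - u 0 ≤ _ := this
      _ = _ := by ring
  have hlim : Filter.Tendsto (fun n : ℕ => C / (1 + ν) + C * (1 / (n : ℝ))) Filter.atTop
      (nhds (C / (1 + ν) + C * 0)) :=
    (tendsto_one_div_atTop_nhds_zero_nat.const_mul C).const_add _
  rw [mul_zero, add_zero] at hlim
  exact ge_of_tendsto hlim (Filter.eventually_atTop.2 ⟨1, fun n h => hn n h⟩)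

/-- The descent inequality for a function with a `ν`-Hölder selection of subgradients. -/
lemma holder_descent {H : Type*} [NormedAddCommGroup H] [InnerProductSpace ℝ H]
    {φ : H → ℝ} {g : H → H} (hsub : ∀ x y, φ x + ⟪g x, y - x⟫ ≤ φ y)
    {ν M : ℝ} (hν : 0 ≤ ν) (hM : 0 ≤ M) (hg : ∀ x y, ‖g x - g y‖ ≤ M * ‖x - y‖ ^ ν)
    (x d : H) :
    φ (x + d) ≤ φ x + ⟪g x, d⟫ + M / (1 + ν) * ‖d‖ ^ (1 + ν) := by
  have key := sub_le_of_increment_le_rpow (ν := ν) (C := M * ‖d‖ ^ (1 + ν))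
    (u := fun t : ℝ => φ (x + t • d) - t * ⟪g x, d⟫) hν (by positivity) (by
      intro s t hs hst
      have ht : 0 ≤ t := hs.trans hst
      have h1 := hsub (x + t • d) (x + s • d)
      have h2 : x + s • d - (x + t • d) = (s - t) • d := by module
      rw [h2, inner_smul_right] at h1
      have h3 : ⟪g (x + t • d) - g x, d⟫ ≤ M * ‖d‖ ^ (1 + ν) * t ^ ν := by
        calc ⟪g (x + t • d) - g x, d⟫ ≤ ‖g (x + t • d) - g x‖ * ‖d‖ := real_inner_le_norm _ _
          _ ≤ M * ‖x + t • d - x‖ ^ ν * ‖d‖ := by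
            gcongr; exact hg _ _
          _ = M * ‖d‖ ^ (1 + ν) * t ^ ν := by
            rw [add_sub_cancel_left, norm_smul, Real.norm_of_nonneg ht,
              Real.mul_rpow ht (norm_nonneg _),
              Real.rpow_add_of_nonneg (norm_nonneg d) zero_le_one hν, Real.rpow_one]
            ring
      rw [inner_sub_left] at h3
      have h4 := mul_le_mul_of_nonneg_left h3 (sub_nonneg.2 hst)
      nlinarith)
  simp only [one_smul, zero_smul, add_zero, one_mul, zero_mul, sub_zero] at key
  have : M * ‖d‖ ^ (1 + ν) / (1 + ν) = M / (1 + ν) * ‖d‖ ^ (1 + ν) := by ring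
  linarith

/-- Young's inequality in the form that replaces a Hölder term by a quadratic one with
additive error `δ / 2`. -/
lemma holder_term_le_quadratic {ν M δ r : ℝ} (hν0 : 0 ≤ ν) (hν1 : ν ≤ 1) (hM : 0 < M)
    (hδ : 0 < δ) (hr : 0 ≤ r) :
    M / (1 + ν) * r ^ (1 + ν)
      ≤ r ^ 2 / (2 * (((1 + ν) / (1 - ν) * δ) ^ ((1 - ν) / (1 + ν)) / M ^ (2 / (1 + ν))))
        + δ / 2 := by
  rcases hν1.eq_or_lt with rfl | hν1
  · norm_num
    have : M / 2 * r ^ 2 = r ^ 2 / (2 * M⁻¹) := by field_simp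
    linarith
  have hp : 0 < 1 + ν := by linarith
  have hm : 0 < 1 - ν := by linarith
  set K := ((1 + ν) / (1 - ν) * δ) ^ ((1 - ν) / (1 + ν)) / M ^ (2 / (1 + ν)) with hK
  have hKpos : 0 < K := by positivity
  have hyoung := Real.geom_mean_le_arith_mean2_weighted (w₁ := (1 + ν) / 2) (w₂ := (1 - ν) / 2)
    (p₁ := r ^ 2 / (K * (1 + ν))) (p₂ := δ / (1 - ν)) (by positivity) (by positivity)
    (by positivity) (by positivity) (by ring)
  have hKpow : K ^ ((1 + ν) / 2) = ((1 + ν) / (1 - ν) * δ) ^ ((1 - ν) / 2) / M := by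
    rw [hK, Real.div_rpow (by positivity) (by positivity), ← Real.rpow_mul (by positivity),
      ← Real.rpow_mul hM.le]
    have e1 : (1 - ν) / (1 + ν) * ((1 + ν) / 2) = (1 - ν) / 2 := by field_simp
    have e2 : 2 / (1 + ν) * ((1 + ν) / 2) = 1 := by field_simp
    rw [e1, e2, Real.rpow_one]
  have hrpow : (r ^ 2) ^ ((1 + ν) / 2) = r ^ (1 + ν) := by
    rw [← Real.rpow_natCast, ← Real.rpow_mul hr]
    congr 1; push_cast; ring
  have hpp : (1 + ν) ^ ((1 + ν) / 2) * (1 + ν) ^ ((1 - ν) / 2) = 1 + ν := by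
    rw [← Real.rpow_add hp]
    have : (1 + ν) / 2 + (1 - ν) / 2 = 1 := by ring
    rw [this, Real.rpow_one]
  have hleft : (r ^ 2 / (K * (1 + ν))) ^ ((1 + ν) / 2) * (δ / (1 - ν)) ^ ((1 - ν) / 2)
      = M / (1 + ν) * r ^ (1 + ν) := by
    have e : (1 + ν) / (1 - ν) * δ = (1 + ν) * (δ / (1 - ν)) := by ring
    rw [Real.div_rpow (by positivity) (by positivity), Real.mul_rpow hKpos.le hp.le, hKpow, hrpow,
      e, Real.mul_rpow hp.le (by positivity)]
    have h1 : 0 < (δ / (1 - ν)) ^ ((1 - ν) / 2) := by positivity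
    rw [show M / (1 + ν) = M / ((1 + ν) ^ ((1 + ν) / 2) * (1 + ν) ^ ((1 - ν) / 2)) by rw [hpp]]
    field_simp
  rw [hleft] at hyoung
  calc _ ≤ _ := hyoung
    _ = _ := by field_simp

/-- Growth of a sequence whose increments `a` satisfy `c * A ^ (q - 1) ≤ a ^ q`. -/
lemma rpow_growth {q c : ℝ} (hq1 : 1 ≤ q) (hq2 : q ≤ 2) (hc : 0 < c) {A a : ℕ → ℝ}
    (hA0 : A 0 = 0) (hA : ∀ k, A (k + 1) = A k + a (k + 1)) (hapos : ∀ k, 0 < a (k + 1))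
    (ha : ∀ k, c * A (k + 1) ^ (q - 1) ≤ a (k + 1) ^ q) (k : ℕ) :
    c * ((k : ℝ) / 2) ^ q ≤ A k := by
  have hq : 0 < q := by linarith
  have hnonneg : ∀ k, 0 ≤ A k := by
    intro k
    induction k with
    | zero => exact hA0.ge
    | succ k ih => rw [hA]; linarith [hapos k]
  have hroot : ∀ k : ℕ, c ^ q⁻¹ * ((k : ℝ) / 2) ≤ A k ^ q⁻¹ := by
    intro k
    induction k with
    | zero => simp [hA0, Real.zero_rpow (inv_pos.2 hq).ne']
    | succ k ih =>
      have hk := hapos k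
      have hpos : 0 < A (k + 1) := by rw [hA]; linarith [hnonneg k]
      have hB := rpow_one_add_le_one_add_mul_self (s := -(a (k + 1) / A (k + 1)))
        (p := q⁻¹) (by
          rw [neg_le_neg_iff, div_le_one hpos, hA]; linarith [hnonneg k])
        (by positivity) (inv_le_one_of_one_le₀ hq1)
      have hAk : A k = A (k + 1) * (1 + -(a (k + 1) / A (k + 1))) := by
        rw [mul_add, mul_neg, mul_div_cancel₀ _ hpos.ne', hA]; ring
      have hfac : 0 ≤ 1 + -(a (k + 1) / A (k + 1)) := by
        have := hnonneg k
        rw [hAk] at this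
        exact nonneg_of_mul_nonneg_right this hpos
      have h1 : A k ^ q⁻¹ ≤ A (k + 1) ^ q⁻¹ * (1 + q⁻¹ * -(a (k + 1) / A (k + 1))) := by
        calc A k ^ q⁻¹ = A (k + 1) ^ q⁻¹ * (1 + -(a (k + 1) / A (k + 1))) ^ q⁻¹ := by
              rw [← Real.mul_rpow hpos.le hfac, ← hAk]
          _ ≤ _ := by gcongr
      have h2 : c ^ q⁻¹ * A (k + 1) ^ (1 - q⁻¹) ≤ a (k + 1) := by
        have := Real.rpow_le_rpow (by positivity) (ha k) (inv_pos.2 hq).le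
        rw [Real.rpow_rpow_inv hk.le hq.ne', Real.mul_rpow hc.le (by positivity),
          ← Real.rpow_mul hpos.le] at this
        have e : (q - 1) * q⁻¹ = 1 - q⁻¹ := by field_simp
        rwa [e] at this
      have h3 : c ^ q⁻¹ ≤ A (k + 1) ^ q⁻¹ * (a (k + 1) / A (k + 1)) := by
        rw [← mul_div_assoc, le_div_iff₀ hpos]
        calc c ^ q⁻¹ * A (k + 1)
            = A (k + 1) ^ q⁻¹ * (c ^ q⁻¹ * A (k + 1) ^ (1 - q⁻¹)) := by
              have : A (k + 1) = A (k + 1) ^ q⁻¹ * A (k + 1) ^ (1 - q⁻¹) := by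
                rw [← Real.rpow_add hpos]; simp
              conv_lhs => rw [this]
              ring
          _ ≤ _ := by gcongr
      have h4 : (1 : ℝ) / 2 ≤ q⁻¹ := by
        rw [one_div]; exact inv_anti₀ hq hq2
      have h5 : 1 / 2 * c ^ q⁻¹ ≤ q⁻¹ * (A (k + 1) ^ q⁻¹ * (a (k + 1) / A (k + 1))) :=
        mul_le_mul h4 h3 (by positivity) (by positivity)
      push_cast
      nlinarith
  have := Real.rpow_le_rpow (by positivity) (hroot k) hq.le
  rwa [Real.rpow_inv_rpow (hnonneg k) hq.ne', Real.mul_rpow (by positivity) (by positivity),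
    Real.rpow_inv_rpow hc.le hq.ne'] at this

/-- The step-size inequality obtained from exact line search along a Hölder subgradient. -/
lemma holder_step_size {H : Type*} [NormedAddCommGroup H] [InnerProductSpace ℝ H]
    {φ : H → ℝ} {g : H → H} (hsub : ∀ x y, φ x + ⟪g x, y - x⟫ ≤ φ y)
    {ν M : ℝ} (hν0 : 0 ≤ ν) (hν1 : ν ≤ 1) (hM : 0 < M)
    (hg : ∀ x y, ‖g x - g y‖ ≤ M * ‖x - y‖ ^ ν) {ε : ℝ} (hε : 0 < ε) {x : H} {h a A : ℝ}
    (hmin : IsMinOn (fun t : ℝ => φ (x - t • g x)) (Set.Ici 0) h) (ha : 0 < a) (hA : 0 < A)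
    (heq : φ (x - h • g x) = φ x - a ^ 2 / (2 * A) * ‖g x‖ ^ 2 + ε * a / (2 * A)) :
    ((1 + ν) / (1 - ν)) ^ ((1 - ν) / (1 + ν)) * (ε ^ ((1 - ν) / (1 + ν)) / M ^ (2 / (1 + ν)))
        * A ^ ((1 + 3 * ν) / (1 + ν) - 1) ≤ a ^ ((1 + 3 * ν) / (1 + ν)) := by
  have hp : 0 < 1 + ν := by linarith
  have hgne : g x ≠ 0 := by
    intro h0
    rw [h0] at heq
    have : 0 < ε * a / (2 * A) := by positivity
    simp at heq
    rcases heq with (h | h) | h <;> linarith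
  have hδ : 0 < ε * a / A := by positivity
  set p := (1 - ν) / (1 + ν) with hpdef
  have hratio : 0 ≤ (1 + ν) / (1 - ν) := div_nonneg hp.le (by linarith)
  set K := ((1 + ν) / (1 - ν) * (ε * a / A)) ^ p / M ^ (2 / (1 + ν)) with hK
  have hKpos : 0 < K := by
    refine div_pos ?_ (by positivity)
    rcases hν1.eq_or_lt with rfl | hν1
    · simp [hpdef]
    · have : 0 < 1 - ν := by linarith
      positivity
  have hdesc := holder_descent hsub hν0 hM.le hg x (-(K • g x))
  rw [← sub_eq_add_neg, inner_neg_right, inner_smul_right, real_inner_self_eq_norm_sq, norm_neg,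
    norm_smul, Real.norm_of_nonneg hKpos.le] at hdesc
  have hyoung := holder_term_le_quadratic hν0 hν1 hM hδ
    (mul_nonneg hKpos.le (norm_nonneg (g x)))
  rw [← hpdef, ← hK] at hyoung
  have hm : φ (x - h • g x) ≤ φ (x - K • g x) := hmin (Set.mem_Ici.2 hKpos.le)
  have e1 : (K * ‖g x‖) ^ 2 / (2 * K) = K * ‖g x‖ ^ 2 / 2 := by field_simp
  have e2 : ε * a / (2 * A) = ε * a / A / 2 := by field_simp
  have h1 : K / 2 * ‖g x‖ ^ 2 ≤ a ^ 2 / (2 * A) * ‖g x‖ ^ 2 := by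
    rw [e1] at hyoung; linarith
  have h2 : K / 2 ≤ a ^ 2 / (2 * A) := le_of_mul_le_mul_right h1 (by positivity)
  have h3 : K * A ≤ a ^ 2 := by
    rw [le_div_iff₀ (by positivity)] at h2; linarith
  have hq : (1 + 3 * ν) / (1 + ν) = 2 - p := by rw [hpdef]; field_simp; ring
  have e3 : K = ((1 + ν) / (1 - ν)) ^ p * (ε ^ p / M ^ (2 / (1 + ν))) * (a ^ p / A ^ p) := by
    rw [hK, Real.mul_rpow hratio hδ.le, Real.div_rpow (by positivity) hA.le,
      Real.mul_rpow hε.le ha.le]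
    ring
  have e4 : A ^ (2 - p - 1) = A / A ^ p := by
    rw [show 2 - p - 1 = 1 - p by ring, Real.rpow_sub hA, Real.rpow_one]
  have e5 : a ^ (2 - p) = a ^ 2 / a ^ p := by
    rw [Real.rpow_sub ha, Real.rpow_two]
  have hap : 0 < a ^ p := by positivity
  rw [hq, e4, e5, le_div_iff₀ hap]
  rw [e3] at h3
  calc _ = _ := by ring
    _ ≤ a ^ 2 := h3

/-- The estimating-sequence inequality of the accelerated dual method. -/
lemma estimating_sequence {H : Type*} [NormedAddCommGroup H] [InnerProductSpace ℝ H]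
    {φ : H → ℝ} {g η lam ζ : ℕ → H} {A a : ℕ → ℝ} {ε : ℝ}
    (hζ0 : ζ 0 = 0) (hA0 : A 0 = 0) (hA : ∀ k, A (k + 1) = A k + a (k + 1))
    (hapos : ∀ k, 0 < a (k + 1)) (hAnonneg : ∀ k, 0 ≤ A k)
    (hmono : ∀ k, φ (lam k) ≤ φ (η k)) (hchoose : ∀ k, 0 ≤ ⟪g k, ζ k - lam k⟫)
    (heq : ∀ k, φ (η (k + 1)) = φ (lam k) - (a (k + 1)) ^ 2 / (2 * A (k + 1)) * ‖g k‖ ^ 2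
      + ε * a (k + 1) / (2 * A (k + 1)))
    (hζ : ∀ k, ζ (k + 1) = ζ k - a (k + 1) • g k) (z : H) (k : ℕ) :
    A k * φ (η k) ≤ ∑ i ∈ range k, a (i + 1) * (φ (lam i) + ⟪g i, z - lam i⟫)
      + ‖z‖ ^ 2 / 2 - ‖z - ζ k‖ ^ 2 / 2 + A k * ε / 2 := by
  induction k with
  | zero => simp [hA0, hζ0]
  | succ k ih =>
    have hk := hapos k
    have hpos : 0 < A (k + 1) := by rw [hA]; linarith [hAnonneg k]
    have h1 : A (k + 1) * φ (η (k + 1)) = A (k + 1) * φ (lam k)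
        - a (k + 1) ^ 2 / 2 * ‖g k‖ ^ 2 + ε * a (k + 1) / 2 := by
      rw [heq]; field_simp
    have h2 : ‖z - ζ (k + 1)‖ ^ 2 = ‖z - ζ k‖ ^ 2 + 2 * a (k + 1) * ⟪g k, z - ζ k⟫
        + a (k + 1) ^ 2 * ‖g k‖ ^ 2 := by
      have : z - ζ (k + 1) = (z - ζ k) + a (k + 1) • g k := by rw [hζ]; abel
      rw [this, norm_add_sq_real, inner_smul_right, norm_smul, real_inner_comm,
        Real.norm_of_nonneg hk.le]
      ring
    have h3 : ⟪g k, z - lam k⟫ = ⟪g k, z - ζ k⟫ + ⟪g k, ζ k - lam k⟫ := by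
      rw [← inner_add_right]; congr 1; abel
    have h4 := mul_le_mul_of_nonneg_left (hmono k) (hAnonneg k)
    have h5 := mul_nonneg hk.le (hchoose k)
    rw [sum_range_succ, h1, h2, h3]
    rw [hA]
    nlinarith

/-- Theorem 19 (Nesterov–Gasnikov–Guminov–Dvurechensky): convergence rate of the
primal-dual universal accelerated gradient method with small-dimensional relaxation
(PDUGDsDR, Algorithm 12) for linearly constrained convex problems whose dual objective
has a ν-Hölder-continuous (sub)gradient. -/
theorem PDUGDsDR_rate
    {E H : Type*} [NormedAddCommGroup E] [NormedSpace ℝ E] [FiniteDimensional ℝ E]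
    [NormedAddCommGroup H] [InnerProductSpace ℝ H] [FiniteDimensional ℝ H]
    -- the primal problem: min {f(x) : A x = b, x ∈ Q}
    (Q : Set E) (hQconv : Convex ℝ Q) (hQclosed : IsClosed Q) (hQne : Q.Nonempty)
    (A : E →L[ℝ] H) (b : H) (f : E → ℝ) (hfconv : ConvexOn ℝ Q f)
    -- the dual objective φ(λ) = ⟨λ, b⟩ + max_{x ∈ Q}(−f(x) − ⟨Aᵀλ, x⟩), its maximizer
    -- selector and its subgradient ∇φ(λ) = b − A x(λ)
    (xφ : H → E) (hxφ : ∀ lam, xφ lam ∈ Q ∧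
      IsMaxOn (fun x => -f x - ⟪lam, A x⟫) Q (xφ lam))
    (φ : H → ℝ) (hφ : ∀ lam, φ lam = ⟪lam, b⟫ + (-f (xφ lam) - ⟪lam, A (xφ lam)⟫))
    -- the ν-Hölder condition on the subgradient
    (ν : ℝ) (hν : ν ∈ Set.Icc (0 : ℝ) 1) (Mν : ℝ) (hMν : 0 < Mν)
    (hHolder : ∀ l₁ l₂ : H,
      ‖(b - A (xφ l₁)) - (b - A (xφ l₂))‖ ≤ Mν * ‖l₁ - l₂‖ ^ ν)
    -- a dual solution bounded by R
    (lamstar : H) (hlamstar : IsMinOn φ Set.univ lamstar)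
    (R : ℝ) (hR : 0 < R) (hlamR : ‖lamstar‖ ≤ R)
    -- the accuracy parameter
    (ε : ℝ) (hε : 0 < ε)
    -- the iterates of PDUGDsDR
    (lam η ζ : ℕ → H) (Aseq a βk hstep : ℕ → ℝ) (xhat : ℕ → E)
    (hη0 : η 0 = 0) (hζ0 : ζ 0 = 0) (hA0 : Aseq 0 = 0) (ha0 : a 0 = 0)
    -- λᵏ = ζᵏ + β_k(ηᵏ − ζᵏ), β_k = argmin over [0,1]
    (hβk : ∀ k, βk k ∈ Set.Icc (0 : ℝ) 1 ∧
      IsMinOn (fun β : ℝ => φ (ζ k + β • (η k - ζ k))) (Set.Icc (0 : ℝ) 1) (βk k))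
    (hlam : ∀ k, lam k = ζ k + βk k • (η k - ζ k))
    -- the chosen subgradient satisfies ⟨∇φ(λᵏ), ζᵏ − λᵏ⟩ ≥ 0
    (hchoose : ∀ k, 0 ≤ ⟪b - A (xφ (lam k)), ζ k - lam k⟫)
    -- ηᵏ⁺¹ = λᵏ − h_{k+1}∇φ(λᵏ), h_{k+1} = argmin over h ≥ 0
    (hhstep : ∀ k, hstep (k + 1) ∈ Set.Ici (0 : ℝ) ∧
      IsMinOn (fun t : ℝ => φ (lam k - t • (b - A (xφ (lam k))))) (Set.Ici (0 : ℝ))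
        (hstep (k + 1)))
    (hη : ∀ k, η (k + 1) = lam k - hstep (k + 1) • (b - A (xφ (lam k))))
    -- a_{k+1} chosen from the equation
    -- φ(ηᵏ⁺¹) = φ(λᵏ) − a²_{k+1}/(2A_{k+1})‖∇φ(λᵏ)‖² + ε a_{k+1}/(2A_{k+1})
    (hAstep : ∀ k, Aseq (k + 1) = Aseq k + a (k + 1))
    (ha : ∀ k, 0 < a (k + 1) ∧
      φ (η (k + 1)) = φ (lam k)
        - (a (k + 1)) ^ 2 / (2 * Aseq (k + 1)) * ‖b - A (xφ (lam k))‖ ^ 2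
        + ε * a (k + 1) / (2 * Aseq (k + 1)))
    (hζ : ∀ k, ζ (k + 1) = ζ k - a (k + 1) • (b - A (xφ (lam k))))
    -- the primal iterates x̂ᵏ⁺¹ = (1/A_{k+1}) Σ_{i=0}^{k} a_{i+1} x(λⁱ)
    (hxhat : ∀ k, xhat (k + 1)
      = (1 / Aseq (k + 1)) • ∑ i ∈ Finset.range (k + 1), a (i + 1) • xφ (lam i)) :
    ∀ k : ℕ, 1 ≤ k →
      ‖A (xhat k) - b‖ ≤ 2 * R / Aseq k + ε / (2 * R)
      ∧ |φ (η k) + f (xhat k)| ≤ 2 * R ^ 2 / Aseq k + ε / 2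
      ∧ ((1 + ν) / (1 - ν)) ^ ((1 - ν) / (1 + ν))
          * ((k : ℝ) ^ ((1 + 3 * ν) / (1 + ν)) * ε ^ ((1 - ν) / (1 + ν))
            / (2 ^ ((1 + 3 * ν) / (1 + ν)) * Mν ^ (2 / (1 + ν))))
        ≤ Aseq k := by
  obtain ⟨hν0, hν1⟩ := hν
  have hp : 0 < 1 + ν := by linarith
  have hapos : ∀ k, 0 < a (k + 1) := fun k => (ha k).1
  have hAnonneg : ∀ k, 0 ≤ Aseq k := by
    intro k
    induction k with
    | zero => exact hA0.ge
    | succ k ih => rw [hAstep]; linarith [hapos k]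
  have hApos : ∀ k, 0 < Aseq (k + 1) := fun k => by
    rw [hAstep]; linarith [hapos k, hAnonneg k]
  have hAsum : ∀ k, ∑ i ∈ range k, a (i + 1) = Aseq k := by
    intro k
    induction k with
    | zero => simp [hA0]
    | succ k ih => rw [sum_range_succ, ih, hAstep]
  have hlower : ∀ l, ∀ x ∈ Q, -f x + ⟪b - A x, l⟫ ≤ φ l := by
    intro l x hx
    have h : -f x - ⟪l, A x⟫ ≤ -f (xφ l) - ⟪l, A (xφ l)⟫ := (hxφ l).2 hx
    rw [hφ, inner_sub_left, real_inner_comm l b, real_inner_comm l (A x)]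
    linarith
  have hval : ∀ l, φ l = -f (xφ l) + ⟪b - A (xφ l), l⟫ := by
    intro l
    rw [hφ, inner_sub_left, real_inner_comm l b, real_inner_comm l (A (xφ l))]
    ring
  have hsub : ∀ x y, φ x + ⟪b - A (xφ x), y - x⟫ ≤ φ y := by
    intro x y
    have h := hlower y (xφ x) (hxφ x).1
    rw [hval x, inner_sub_right]
    linarith
  have hmono : ∀ k, φ (lam k) ≤ φ (η k) := by
    intro k
    have h : φ (ζ k + βk k • (η k - ζ k)) ≤ φ (ζ k + (1 : ℝ) • (η k - ζ k)) :=
      (hβk k).2 (Set.right_mem_Icc.2 zero_le_one)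
    rwa [← hlam, one_smul, add_sub_cancel] at h
  intro k hk
  obtain ⟨n, rfl⟩ : ∃ n, k = n + 1 := ⟨k - 1, by omega⟩
  have hAn := hApos n
  have hw : ∑ i ∈ range (n + 1), a (i + 1) / Aseq (n + 1) = 1 := by
    rw [← sum_div, hAsum, div_self hAn.ne']
  have hw0 : ∀ i ∈ range (n + 1), 0 ≤ a (i + 1) / Aseq (n + 1) := fun i _ =>
    div_nonneg (hapos i).le hAn.le
  have hmem : ∀ i ∈ range (n + 1), xφ (lam i) ∈ Q := fun i _ => (hxφ _).1
  have hx : xhat (n + 1) = ∑ i ∈ range (n + 1), (a (i + 1) / Aseq (n + 1)) • xφ (lam i) := by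
    rw [hxhat, smul_sum]
    refine sum_congr rfl fun i _ => ?_
    rw [smul_smul]; congr 1; ring
  have hxQ : xhat (n + 1) ∈ Q := by
    rw [hx]; exact hQconv.sum_mem hw0 hw hmem
  have hfx : Aseq (n + 1) * f (xhat (n + 1)) ≤ ∑ i ∈ range (n + 1), a (i + 1) * f (xφ (lam i)) := by
    have h := hfconv.map_sum_le hw0 hw hmem
    rw [← hx] at h
    calc _ ≤ _ := mul_le_mul_of_nonneg_left h hAn.le
      _ = _ := by
        rw [mul_sum]
        refine sum_congr rfl fun i _ => ?_
        rw [smul_eq_mul]; field_simp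
  have hAx : Aseq (n + 1) • A (xhat (n + 1)) = ∑ i ∈ range (n + 1), a (i + 1) • A (xφ (lam i)) := by
    rw [hxhat, map_smul, smul_smul, mul_one_div_cancel hAn.ne', one_smul, map_sum]
    simp
  have hgap : ∀ z : H, Aseq (n + 1) * φ (η (n + 1))
      ≤ Aseq (n + 1) * (-f (xhat (n + 1)) + ⟪b - A (xhat (n + 1)), z⟫)
        + ‖z‖ ^ 2 / 2 + Aseq (n + 1) * ε / 2 := by
    intro z
    have h := estimating_sequence (g := fun k => b - A (xφ (lam k))) hζ0 hA0 hAstep hapos hAnonneg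
      hmono hchoose (fun k => (ha k).2) hζ z (n + 1)
    have hlin : ∑ i ∈ range (n + 1), a (i + 1) * (φ (lam i) + ⟪b - A (xφ (lam i)), z - lam i⟫)
        = -∑ i ∈ range (n + 1), a (i + 1) * f (xφ (lam i))
          + Aseq (n + 1) * ⟪b - A (xhat (n + 1)), z⟫ := by
      have h1 : Aseq (n + 1) * ⟪b - A (xhat (n + 1)), z⟫
          = ∑ i ∈ range (n + 1), a (i + 1) * ⟪b - A (xφ (lam i)), z⟫ := by
        rw [← real_inner_smul_left, smul_sub, hAx, ← hAsum, sum_smul, ← sum_sub_distrib, sum_inner]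
        refine sum_congr rfl fun i _ => ?_
        rw [← smul_sub, real_inner_smul_left]
      rw [h1, ← sum_neg_distrib, ← sum_add_distrib]
      refine sum_congr rfl fun i _ => ?_
      rw [hval (lam i), inner_sub_right]
      ring
    have := sq_nonneg ‖z - ζ (n + 1)‖
    rw [hlin] at h
    linarith
  set r := b - A (xhat (n + 1)) with hr
  have hnorm : ‖A (xhat (n + 1)) - b‖ = ‖r‖ := norm_sub_rev _ _
  have hup : φ (η (n + 1)) + f (xhat (n + 1))
      ≤ -(2 * R * ‖r‖) + 2 * R ^ 2 / Aseq (n + 1) + ε / 2 := by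
    obtain ⟨z, hz, hrz⟩ : ∃ z : H, ‖z‖ ≤ 2 * R ∧ ⟪r, z⟫ = -(2 * R * ‖r‖) := by
      by_cases h0 : r = 0
      · exact ⟨0, by simpa using hR.le, by simp [h0]⟩
      · have hr0 : 0 < ‖r‖ := norm_pos_iff.2 h0
        refine ⟨-((2 * R / ‖r‖) • r), ?_, ?_⟩
        · rw [norm_neg, norm_smul, Real.norm_of_nonneg (by positivity), div_mul_cancel₀ _ hr0.ne']
        · rw [inner_neg_right, inner_smul_right, real_inner_self_eq_norm_sq]
          field_simp
    have h := hgap z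
    rw [hrz] at h
    have hz2 : ‖z‖ ^ 2 ≤ (2 * R) ^ 2 := by gcongr
    refine le_of_mul_le_mul_left ?_ hAn
    have e : Aseq (n + 1) * (-(2 * R * ‖r‖) + 2 * R ^ 2 / Aseq (n + 1) + ε / 2)
        = Aseq (n + 1) * -(2 * R * ‖r‖) + 2 * R ^ 2 + Aseq (n + 1) * ε / 2 := by
      field_simp
    rw [e]
    nlinarith
  have hlow : -(R * ‖r‖) ≤ φ (η (n + 1)) + f (xhat (n + 1)) := by
    have h1 : φ lamstar ≤ φ (η (n + 1)) := hlamstar (Set.mem_univ _)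
    have h2 := hlower lamstar _ hxQ
    have h3 := neg_le_of_abs_le (abs_real_inner_le_norm r lamstar)
    have h4 : ‖r‖ * ‖lamstar‖ ≤ ‖r‖ * R := by gcongr
    linarith
  have hRr : R * ‖r‖ ≤ 2 * R ^ 2 / Aseq (n + 1) + ε / 2 := by linarith
  have hRr0 : 0 ≤ R * ‖r‖ := by positivity
  refine ⟨?_, ?_, ?_⟩
  · rw [hnorm]
    refine le_of_mul_le_mul_left ?_ hR
    calc _ ≤ _ := hRr
      _ = _ := by field_simp
  · rw [abs_le]
    constructor <;> linarith
  · have hq1 : 1 ≤ (1 + 3 * ν) / (1 + ν) := by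
      rw [le_div_iff₀ hp]; linarith
    have hq2 : (1 + 3 * ν) / (1 + ν) ≤ 2 := by
      rw [div_le_iff₀ hp]; linarith
    have hratio : 0 < ((1 + ν) / (1 - ν)) ^ ((1 - ν) / (1 + ν)) := by
      rcases hν1.eq_or_lt with rfl | hν1
      · simp
      · have : 0 < 1 - ν := by linarith
        positivity
    have h := rpow_growth hq1 hq2
      (mul_pos hratio (by positivity :
        0 < ε ^ ((1 - ν) / (1 + ν)) / Mν ^ (2 / (1 + ν))))
      hA0 hAstep hapos
      (fun k => holder_step_size (g := fun l => b - A (xφ l)) hsub hν0 hν1 hMν hHolder hε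
        (hhstep k).2 (hapos k) (hApos k) (by rw [← hη]; exact (ha k).2)) (n + 1)
    rw [Real.div_rpow (Nat.cast_nonneg _) zero_le_two] at h
    calc _ = _ := by ring
      _ ≤ _ := h
end
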